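/- Every 2-extendable non-bipartite finite simple graph on 12 vertices has at least 20 edges, and there exists a 2-extendable non-bipartite finite simple graph on 12 vertices with exactly 20 edges; hence ε(12,2) = 20. -/

import Mathlib

open SimpleGraph

/-- `G` is `n`-factor-critical if for every set `S` of exactly `n` vertices,
the graph obtained by deleting `S` has a perfect matching; formalized as:
there is a matching of `G` whose vertex set is exactly the complement of `S`. -/
def IsFactorCritical {V : Type*} (G : SimpleGraph V) (n : ℕ) : Prop :=
  ∀ S : Finset V, S.card = n →
    ∃ M : G.Subgraph, M.IsMatching ∧ M.verts = (↑S : Set V)ᶜ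

/-- `G` is `k`-extendable if it is connected, has a matching with `k` edges,
and every matching with `k` edges is contained in a perfect matching. -/
def IsExtendable {V : Type*} (G : SimpleGraph V) (k : ℕ) : Prop :=
  G.Connected ∧
  (∃ M : G.Subgraph, M.IsMatching ∧ M.edgeSet.ncard = k) ∧
  ∀ M : G.Subgraph, M.IsMatching → M.edgeSet.ncard = k →
    ∃ P : G.Subgraph, P.IsPerfectMatching ∧ M ≤ P

local notation:max "ifB" b:max t:max e:max => Bool.rec (motive := fun _ => Bool) e t b

local notation:max "ifN" b:max t:max e:max => Bool.rec (motive := fun _ => ℕ) e t b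

/-- `force x k = k x`; the kernel evaluates `x` to a literal before it substitutes it into `k`. -/
noncomputable def force (x : ℕ) (k : ℕ → Bool) : Bool :=
  Nat.rec (k 0) (fun n _ => k (Nat.succ n)) x

/-- The neighbours of the label `i`, as a bit mask, in the adjacency matrix `A` of a graph on the
labels `0, …, 11`; the rows of the matrix are stored in `A` from the highest bits downwards. -/
noncomputable def row (A i : ℕ) : ℕ :=
  Nat.land (Nat.shiftRight A (Nat.sub 132 (Nat.mul 12 i))) 4095

/-- The two entries of the adjacency matrix that stand for the edge `ij`. -/
noncomputable def edgeBits (i j : ℕ) : ℕ :=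
  Nat.lor (Nat.pow 2 (Nat.sub (Nat.add 132 j) (Nat.mul 12 i)))
    (Nat.pow 2 (Nat.sub (Nat.add 132 i) (Nat.mul 12 j)))

/-- The position of the lowest bit of `m`. -/
noncomputable def pick (m : ℕ) : ℕ := Nat.log2 (Nat.xor m (Nat.land m (Nat.sub m 1)))

/-- Can the vertex just removed from `mask` be matched to a member of `nb` in such a way that the
vertices of `C` left over can be matched as well? -/
noncomputable def matchLoop (A C : ℕ) : ℕ → ℕ → ℕ → Bool :=
  Nat.rec (fun _ _ => true) fun _ ih mask nb =>
    ifB (Nat.beq nb 0) false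
      (force (Nat.pow 2 (pick nb)) fun w =>
        ifB (force (Nat.xor mask w) fun mk =>
          force (Nat.land mk C) fun m =>
            ifB (Nat.beq m 0) true
              (force (pick m) fun v => ih (Nat.xor mk (Nat.pow 2 v)) (Nat.land (row A v) mk)))
          true
          (ih mask (Nat.xor nb w)))

/-- Can the members of `C` in the mask `mk` be covered by a matching inside `mk`? -/
noncomputable def canMatch (A C mk : ℕ) : Bool :=
  force (Nat.land mk C) fun m =>
    ifB (Nat.beq m 0) true
      (force (pick m) fun v => matchLoop A C 60 (Nat.xor mk (Nat.pow 2 v)) (Nat.land (row A v) mk))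

/-- Every pair of edges in the list that is present in `A` extends to a matching that covers the
vertices of `C`. -/
noncomputable def testAll (A C : ℕ) (L : List (ℕ × ℕ × ℕ × ℕ)) : Bool :=
  List.rec true (fun t _ ih =>
    ifB (force (Nat.lor (edgeBits t.1 t.2.1) (edgeBits t.2.2.1 t.2.2.2)) fun m =>
      ifB (Nat.beq (Nat.land A m) m)
        (force (Nat.xor (Nat.xor 4095 (Nat.lor (Nat.pow 2 t.1) (Nat.pow 2 t.2.1)))
            (Nat.lor (Nat.pow 2 t.2.2.1) (Nat.pow 2 t.2.2.2)))
          fun mk => canMatch A C mk) true) ih false) L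

/-- The labels `i < d` on the `k`-cycle whose distance from `d` on the cycle is not two. -/
noncomputable def far (k d : ℕ) : ℕ :=
  ifN (Nat.ble k d) 0
    (Nat.land (Nat.sub (Nat.pow 2 d) 1) (Nat.xor 4095 (Nat.lor (Nat.pow 2 (Nat.sub d 2))
      (ifN (Nat.ble (Nat.sub k 2) d) (Nat.pow 2 (Nat.sub (Nat.add d 2) k)) 0))))

/-- `1` if the masks `T` and `x` meet, `0` otherwise. -/
noncomputable def meets (T x : ℕ) : ℕ := ifN (Nat.beq (Nat.land T x) 0) 0 1

/-- The first label from `y` onwards whose row is not `r`. -/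
noncomputable def nextRow (A r : ℕ) : ℕ → ℕ → ℕ :=
  Nat.rec (fun y => y) fun _ ih y => ifN (Nat.beq (row A y) r) (ih (Nat.succ y)) y

/-- Depth-first search over the graphs that contain the graph `A` on the labels below `n`.
The neighbourhoods of the labels below `d` are complete, and the adjacency of `d` to the labels
below `x` is decided.  The masks `T2`, `T3`, `T4` hold the labels of degree at least `2`, `3`, `4`
in `A`, and `e` is the excess of `A` over degree three.  The first `k` labels form a shortest odd
cycle.  The value `true` means that no graph with the required properties was found. -/
noncomputable def search (k : ℕ) (tests : List (ℕ × ℕ × ℕ × ℕ)) :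
    ℕ → ℕ → ℕ → ℕ → ℕ → ℕ → ℕ → ℕ → ℕ → Bool :=
  Nat.rec (fun _ _ _ _ _ _ _ _ => false) fun _ ih n d x A T2 T3 T4 e =>
    ifB (Nat.beq d n) (Nat.blt n 12) (
    ifB (Nat.blt x n)
      (ifB (ifB (Nat.beq (Nat.land (row A x) (Nat.lor (row A d) (far k d))) 0)
          (force (Nat.pow 2 x) fun bx =>
           force (Nat.add e (Nat.add (meets T3 (Nat.pow 2 d)) (meets T3 bx))) fun e' =>
            ifB (Nat.ble e' 2)
              (force (Nat.lor bx (Nat.pow 2 d)) fun b => force (Nat.lor A (edgeBits d x)) fun A' =>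
                ih n d (Nat.succ x) A' (Nat.lor T2 b) (Nat.lor T3 (Nat.land T2 b))
                  (Nat.lor T4 (Nat.land T3 b)) e')
              true)
          true)
          (force (nextRow A (row A x) 12 (Nat.succ x)) fun y => ih n d y A T2 T3 T4 e) false)
      (force (Nat.pow 2 d) fun bd => ifB
        (ifB (Nat.beq (Nat.land T3 bd) 0) true
          (ifB (ifB (Nat.blt d k)
              (ifB (Nat.beq (Nat.land T4 bd) 0) false (Nat.beq (Nat.land T4 1) 0)) false) true
            (ifB (ifB (Nat.ble k (Nat.succ d))
                (force (Nat.lor (Nat.sub (Nat.pow 2 (Nat.succ d)) 1) (ifN (Nat.ble 2 e) T3 0))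
                  fun C => testAll A C tests) true)
              (force (Nat.succ d) fun d' =>
                ih n d' (ifN (Nat.ble k d') (Nat.succ d') k) A T2 T3 T4 e)
              true)))
        (ifB (Nat.blt n 12)
          (force (Nat.add e (meets T3 bd)) fun e' =>
            ifB (Nat.ble e' 2)
              (force (Nat.lor A (edgeBits d n)) fun A' => force (Nat.succ n) fun n' =>
                ih n' d n' A' (Nat.lor T2 bd) (Nat.lor T3 (Nat.land T2 bd))
                  (Nat.lor T4 (Nat.land T3 bd)) e')
              true)
          true)
        false))

/-- The first `i` edges of the cycle on the labels below `k`. -/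
noncomputable def cycleBits (k i : ℕ) : ℕ :=
  Nat.rec 0 (fun i A => Nat.lor A (edgeBits i (Nat.mod (Nat.succ i) k))) i

/-- The search that starts from the `k`-cycle. -/
noncomputable def searchFrom (k : ℕ) (tests : List (ℕ × ℕ × ℕ × ℕ)) : Bool :=
  force (cycleBits k k) fun A => search k tests 300 k 0 k A (Nat.sub (Nat.pow 2 k) 1) 0 0 0

/-- Pairs of edges to be extended in the search from the `5`-cycle. -/
def testsFive : List (ℕ × ℕ × ℕ × ℕ) :=
  [(0, 4, 2, 8), (0, 1, 2, 3), (0, 6, 2, 3), (2, 3, 7, 10), (0, 5, 2, 3), (0, 1, 3, 9),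
   (0, 4, 2, 9), (0, 1, 3, 4), (2, 3, 7, 9), (0, 4, 6, 8), (0, 4, 1, 2), (3, 4, 5, 9),
   (0, 4, 2, 3), (2, 3, 7, 11), (1, 2, 5, 10), (3, 4, 5, 10), (3, 4, 5, 7), (0, 1, 3, 10),
   (0, 1, 7, 9), (0, 4, 7, 9), (0, 4, 7, 11), (2, 3, 6, 9), (0, 1, 3, 5), (0, 4, 6, 11),
   (2, 3, 7, 8), (1, 2, 5, 8), (0, 1, 3, 7), (1, 2, 5, 9), (0, 4, 2, 5), (0, 1, 3, 6),
   (2, 3, 6, 10), (0, 1, 3, 8), (1, 2, 4, 10), (3, 4, 5, 8), (0, 4, 7, 8), (0, 5, 1, 7),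
   (0, 5, 1, 8), (0, 1, 5, 10), (0, 1, 6, 9), (1, 2, 6, 9), (0, 4, 8, 10), (3, 4, 6, 8),
   (3, 4, 6, 11), (0, 1, 6, 10), (0, 1, 5, 9), (0, 4, 5, 10), (0, 4, 7, 10), (0, 5, 4, 7),
   (3, 4, 6, 9), (0, 1, 5, 11)]

/-- Pairs of edges to be extended in the search from the `7`-cycle. -/
def testsSeven : List (ℕ × ℕ × ℕ × ℕ) :=
  [(3, 4, 7, 9), (3, 4, 7, 11), (4, 5, 8, 10), (0, 8, 2, 3), (1, 2, 7, 10), (0, 1, 3, 9),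
   (5, 6, 7, 9), (0, 6, 4, 10), (0, 1, 2, 3), (2, 9, 4, 5), (2, 3, 5, 10), (5, 6, 7, 10),
   (2, 3, 8, 9), (2, 3, 8, 10), (0, 8, 4, 5), (3, 4, 6, 11), (0, 6, 2, 9), (2, 3, 5, 11),
   (3, 4, 7, 10), (0, 6, 7, 8), (0, 1, 3, 10), (0, 6, 4, 5), (1, 2, 7, 11), (0, 1, 5, 10),
   (0, 1, 5, 11), (0, 6, 4, 11), (0, 8, 6, 9), (0, 8, 6, 11)]

theorem searchFrom_five : searchFrom 5 testsFive = true := by decide +kernel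

theorem searchFrom_seven : searchFrom 7 testsSeven = true := by decide +kernel

theorem searchFrom_nine : searchFrom 9 [] = true := by decide +kernel

theorem searchFrom_eleven : searchFrom 11 [] = true := by decide +kernel

section Unfolding

theorem force_eq (x : ℕ) (k : ℕ → Bool) : force x k = k x := by cases x <;> rfl

theorem ifB_eq (b t e : Bool) : (ifB b t e) = if b then t else e := by cases b <;> rfl

theorem ifN_eq (b : Bool) (t e : ℕ) : (ifN b t e) = if b then t else e := by cases b <;> rfl

theorem matchLoop_succ (A C m mask nb : ℕ) : matchLoop A C (m + 1) mask nb =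
    if nb = 0 then false else
      if (if (mask ^^^ 2 ^ pick nb) &&& C = 0 then true else
          matchLoop A C m ((mask ^^^ 2 ^ pick nb) ^^^ 2 ^ pick ((mask ^^^ 2 ^ pick nb) &&& C))
            (row A (pick ((mask ^^^ 2 ^ pick nb) &&& C)) &&& (mask ^^^ 2 ^ pick nb))) then true
      else matchLoop A C m mask (nb ^^^ 2 ^ pick nb) := by
  have : matchLoop A C (m + 1) mask nb = ifB (Nat.beq nb 0) false
      (force (Nat.pow 2 (pick nb)) fun w =>
        ifB (force (Nat.xor mask w) fun mk =>
          force (Nat.land mk C) fun m' =>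
            ifB (Nat.beq m' 0) true
              (force (pick m') fun v =>
                matchLoop A C m (Nat.xor mk (Nat.pow 2 v)) (Nat.land (row A v) mk)))
          true
          (matchLoop A C m mask (Nat.xor nb w))) := rfl
  rw [this]
  simp only [force_eq, ifB_eq, Nat.beq_eq]
  rfl

theorem canMatch_eq (A C mk : ℕ) : canMatch A C mk =
    if mk &&& C = 0 then true else
      matchLoop A C 60 (mk ^^^ 2 ^ pick (mk &&& C)) (row A (pick (mk &&& C)) &&& mk) := by
  unfold canMatch
  simp only [force_eq, ifB_eq, Nat.beq_eq]
  rfl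

theorem testAll_cons (A C a b c d : ℕ) (L : List (ℕ × ℕ × ℕ × ℕ)) :
    testAll A C ((a, b, c, d) :: L) =
      ((if A &&& (edgeBits a b ||| edgeBits c d) = edgeBits a b ||| edgeBits c d then
        canMatch A C ((4095 ^^^ (2 ^ a ||| 2 ^ b)) ^^^ (2 ^ c ||| 2 ^ d)) else true) &&
        testAll A C L) := by
  have : testAll A C ((a, b, c, d) :: L) =
    ifB (force (Nat.lor (edgeBits a b) (edgeBits c d)) fun m =>
      ifB (Nat.beq (Nat.land A m) m)
        (force (Nat.xor (Nat.xor 4095 (Nat.lor (Nat.pow 2 a) (Nat.pow 2 b)))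
            (Nat.lor (Nat.pow 2 c) (Nat.pow 2 d)))
          fun mk => canMatch A C mk) true) (testAll A C L) false := rfl
  rw [this]
  simp only [force_eq, ifB_eq, Nat.beq_eq]
  generalize testAll A C L = t
  cases t
  · simp
  · simp only [Bool.if_false_right, Bool.and_true, Bool.decide_eq_true]
    rfl

theorem far_eq (k d : ℕ) : far k d = if k ≤ d then 0 else
    (2 ^ d - 1) &&& (4095 ^^^ (2 ^ (d - 2) ||| if k - 2 ≤ d then 2 ^ (d + 2 - k) else 0)) := by
  unfold far
  simp only [ifN_eq, Nat.ble_eq]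
  rfl

theorem meets_eq (T x : ℕ) : meets T x = if T &&& x = 0 then 0 else 1 := by
  unfold meets
  simp only [ifN_eq, Nat.beq_eq]
  rfl

theorem nextRow_succ (A r m y : ℕ) :
    nextRow A r (m + 1) y = if row A y = r then nextRow A r m (y + 1) else y := by
  have : nextRow A r (m + 1) y = ifN (Nat.beq (row A y) r) (nextRow A r m (Nat.succ y)) y := rfl
  rw [this]
  simp only [ifN_eq, Nat.beq_eq]

theorem search_succ (k : ℕ) (L : List (ℕ × ℕ × ℕ × ℕ)) (m n d x A T2 T3 T4 e : ℕ) :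
    search k L (m + 1) n d x A T2 T3 T4 e = true ↔
    if d = n then n < 12 else
    if x < n then
      (row A x &&& (row A d ||| far k d) = 0 → e + (meets T3 (2 ^ d) + meets T3 (2 ^ x)) ≤ 2 →
        search k L m n d (x + 1) (A ||| edgeBits d x) (T2 ||| (2 ^ x ||| 2 ^ d))
          (T3 ||| (T2 &&& (2 ^ x ||| 2 ^ d))) (T4 ||| (T3 &&& (2 ^ x ||| 2 ^ d)))
          (e + (meets T3 (2 ^ d) + meets T3 (2 ^ x))) = true) ∧
      search k L m n d (nextRow A (row A x) 12 (x + 1)) A T2 T3 T4 e = true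
    else
      (T3 &&& 2 ^ d ≠ 0 → (d < k → T4 &&& 2 ^ d ≠ 0 → T4 &&& 1 ≠ 0) →
        (k ≤ d + 1 → testAll A ((2 ^ (d + 1) - 1) ||| if 2 ≤ e then T3 else 0) L = true) →
        search k L m n (d + 1) (if k ≤ d + 1 then d + 2 else k) A T2 T3 T4 e = true) ∧
      (n < 12 → e + meets T3 (2 ^ d) ≤ 2 →
        search k L m (n + 1) d (n + 1) (A ||| edgeBits d n) (T2 ||| 2 ^ d)
          (T3 ||| (T2 &&& 2 ^ d)) (T4 ||| (T3 &&& 2 ^ d)) (e + meets T3 (2 ^ d)) = true) := by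
  have : search k L (m + 1) n d x A T2 T3 T4 e =
    ifB (Nat.beq d n) (Nat.blt n 12) (
    ifB (Nat.blt x n)
      (ifB (ifB (Nat.beq (Nat.land (row A x) (Nat.lor (row A d) (far k d))) 0)
          (force (Nat.pow 2 x) fun bx =>
           force (Nat.add e (Nat.add (meets T3 (Nat.pow 2 d)) (meets T3 bx))) fun e' =>
            ifB (Nat.ble e' 2)
              (force (Nat.lor bx (Nat.pow 2 d)) fun b => force (Nat.lor A (edgeBits d x)) fun A' =>
                search k L m n d (Nat.succ x) A' (Nat.lor T2 b) (Nat.lor T3 (Nat.land T2 b))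
                  (Nat.lor T4 (Nat.land T3 b)) e')
              true)
          true)
          (force (nextRow A (row A x) 12 (Nat.succ x)) fun y => search k L m n d y A T2 T3 T4 e)
          false)
      (force (Nat.pow 2 d) fun bd => ifB
        (ifB (Nat.beq (Nat.land T3 bd) 0) true
          (ifB (ifB (Nat.blt d k)
              (ifB (Nat.beq (Nat.land T4 bd) 0) false (Nat.beq (Nat.land T4 1) 0)) false) true
            (ifB (ifB (Nat.ble k (Nat.succ d))
                (force (Nat.lor (Nat.sub (Nat.pow 2 (Nat.succ d)) 1) (ifN (Nat.ble 2 e) T3 0))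
                  fun C => testAll A C L) true)
              (force (Nat.succ d) fun d' =>
                search k L m n d' (ifN (Nat.ble k d') (Nat.succ d') k) A T2 T3 T4 e)
              true)))
        (ifB (Nat.blt n 12)
          (force (Nat.add e (meets T3 bd)) fun e' =>
            ifB (Nat.ble e' 2)
              (force (Nat.lor A (edgeBits d n)) fun A' => force (Nat.succ n) fun n' =>
                search k L m n' d n' A' (Nat.lor T2 bd) (Nat.lor T3 (Nat.land T2 bd))
                  (Nat.lor T4 (Nat.land T3 bd)) e')
              true)
          true)
        false)) := rfl
  rw [this]
  simp only [force_eq, ifB_eq, ifN_eq, Nat.beq_eq, Nat.ble_eq, Nat.blt_eq, Nat.succ_eq_add_one]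
  change (if d = n then _ else if x < n then (if (if row A x &&& (row A d ||| far k d) = 0 then
    (if e + (meets T3 (2 ^ d) + meets T3 (2 ^ x)) ≤ 2 then
        search k L m n d (x + 1) (A ||| edgeBits d x) (T2 ||| (2 ^ x ||| 2 ^ d))
          (T3 ||| (T2 &&& (2 ^ x ||| 2 ^ d))) (T4 ||| (T3 &&& (2 ^ x ||| 2 ^ d)))
          (e + (meets T3 (2 ^ d) + meets T3 (2 ^ x))) else true) else true) = true then _ else _)
    else if (if T3 &&& 2 ^ d = 0 then true else if (if d < k then
      if T4 &&& 2 ^ d = 0 then false else Nat.beq (T4 &&& 1) 0 else false) = true then true else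
        if (if k ≤ d + 1 then testAll A ((2 ^ (d + 1) - 1) ||| if 2 ≤ e then T3 else 0) L
          else true) = true then _ else true) = true then
      if n < 12 then if e + meets T3 (2 ^ d) ≤ 2 then
        search k L m (n + 1) d (n + 1) (A ||| edgeBits d n) (T2 ||| 2 ^ d)
          (T3 ||| (T2 &&& 2 ^ d)) (T4 ||| (T3 &&& 2 ^ d)) (e + meets T3 (2 ^ d)) else true
      else true else false) = true ↔ _
  have hb : Nat.beq (T4 &&& 1) 0 = decide (T4 &&& 1 = 0) := by
    rw [Bool.eq_iff_iff, Nat.beq_eq, decide_eq_true_iff]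
  rw [hb]
  generalize search k L m n d (x + 1) (A ||| edgeBits d x) (T2 ||| (2 ^ x ||| 2 ^ d))
    (T3 ||| (T2 &&& (2 ^ x ||| 2 ^ d))) (T4 ||| (T3 &&& (2 ^ x ||| 2 ^ d)))
    (e + (meets T3 (2 ^ d) + meets T3 (2 ^ x))) = s₁
  generalize search k L m n d (nextRow A (row A x) 12 (x + 1)) A T2 T3 T4 e = s₂
  generalize search k L m (n + 1) d (n + 1) (A ||| edgeBits d n) (T2 ||| 2 ^ d)
    (T3 ||| (T2 &&& 2 ^ d)) (T4 ||| (T3 &&& 2 ^ d)) (e + meets T3 (2 ^ d)) = s₃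
  generalize search k L m n (d + 1) (if k ≤ d + 1 then d + 2 else k) A T2 T3 T4 e = s₄
  generalize testAll A ((2 ^ (d + 1) - 1) ||| if 2 ≤ e then T3 else 0) L = s₅
  clear this hb
  generalize T4 &&& 1 = u
  generalize T4 &&& 2 ^ d = v
  generalize T3 &&& 2 ^ d = w
  generalize row A x &&& (row A d ||| far k d) = r
  by_cases h1 : d = n
  · simp [h1]
  by_cases h2 : x < n
  · simp only [h1, h2, if_true, if_false]
    cases s₁ <;> cases s₂ <;> grind
  · simp only [h1, h2, if_false]
    cases s₃ <;> cases s₄ <;> cases s₅ <;> grind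

end Unfolding

section Bits

theorem testBit_row (A i j : ℕ) :
    (row A i).testBit j = (A.testBit (132 - 12 * i + j) && decide (j < 12)) := by
  have : row A i = (A >>> (132 - 12 * i)) &&& (2 ^ 12 - 1) := rfl
  rw [this, Nat.testBit_and, Nat.testBit_shiftRight, Nat.testBit_two_pow_sub_one]

theorem lt_of_testBit_row {A i j : ℕ} (h : (row A i).testBit j = true) : j < 12 := by
  rw [testBit_row] at h
  simp_all

theorem testBit_edgeBits {p q i j : ℕ} (hp : p < 12) (hq : q < 12) (hi : i < 12) (hj : j < 12) :
    (edgeBits p q).testBit (132 - 12 * i + j) = true ↔ i = p ∧ j = q ∨ i = q ∧ j = p := by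
  have : edgeBits p q = 2 ^ (132 + q - 12 * p) ||| 2 ^ (132 + p - 12 * q) := rfl
  rw [this, Nat.testBit_or, Nat.testBit_two_pow, Nat.testBit_two_pow]
  simp only [Bool.or_eq_true, decide_eq_true_eq]
  omega

theorem testBit_row_or_edgeBits {A p q i j : ℕ} (hp : p < 12) (hq : q < 12) (hi : i < 12) :
    (row (A ||| edgeBits p q) i).testBit j = true ↔
      (row A i).testBit j = true ∨ i = p ∧ j = q ∨ i = q ∧ j = p := by
  rw [testBit_row, testBit_row, Nat.testBit_or]
  by_cases hj : j < 12
  · have := testBit_edgeBits hp hq hi hj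
    simp_all
  · have : j ≠ p ∧ j ≠ q := by omega
    simp [hj, this.1, this.2]

theorem testBit_pick {m : ℕ} (hm : m ≠ 0) : m.testBit (pick m) = true := by
  have hz : m ^^^ (m &&& (m - 1)) ≠ 0 := by
    intro h
    have h1 := Nat.xor_eq_zero_iff.1 h
    have h2 : m &&& (m - 1) ≤ m - 1 := Nat.and_le_right
    omega
  have h := Nat.testBit_log2 hz
  rw [Nat.testBit_xor, Nat.testBit_and] at h
  change m.testBit (Nat.log2 (m ^^^ (m &&& (m - 1)))) = true
  by_contra hc
  simp [hc] at h

theorem and_two_pow_ne_zero {T i : ℕ} : T &&& 2 ^ i ≠ 0 ↔ T.testBit i = true := by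
  rw [Nat.and_two_pow]
  cases T.testBit i <;> simp

theorem meets_two_pow (T i : ℕ) : meets T (2 ^ i) = if T.testBit i then 1 else 0 := by
  rw [meets_eq]
  have := @and_two_pow_ne_zero T i
  by_cases h : T.testBit i = true <;> simp_all

theorem exists_testBit_of_and_ne_zero {a b : ℕ} (h : a &&& b ≠ 0) :
    ∃ i, a.testBit i = true ∧ b.testBit i = true := by
  obtain ⟨i, hi⟩ := Nat.exists_testBit_of_ne_zero h
  exact ⟨i, by simpa using hi⟩

theorem testBit_far {k d i : ℕ} (hd : d ≤ 12) (h : (far k d).testBit i = true) :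
    d < k ∧ i < d ∧ i + 2 ≠ d ∧ d + 2 ≠ i + k := by
  have h4095 : 4095 = 2 ^ 12 - 1 := rfl
  rw [far_eq, h4095] at h
  split_ifs at h with h1 h2
  · simp at h
  · simp only [Nat.testBit_and, Nat.testBit_xor, Nat.testBit_or, Nat.testBit_two_pow,
      Nat.testBit_two_pow_sub_one, Bool.and_eq_true, decide_eq_true_eq] at h
    have hi : i < 12 := by omega
    simp only [hi, decide_true, Bool.true_xor, Bool.not_eq_true', Bool.or_eq_false_iff,
      decide_eq_false_iff_not] at h
    omega
  · simp only [Nat.testBit_and, Nat.testBit_xor, Nat.testBit_or, Nat.testBit_two_pow,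
      Nat.testBit_two_pow_sub_one, Bool.and_eq_true, decide_eq_true_eq, Nat.zero_testBit] at h
    have hi : i < 12 := by omega
    simp only [hi, decide_true, Bool.true_xor, Bool.not_eq_true', Bool.or_eq_false_iff,
      decide_eq_false_iff_not] at h
    omega

theorem le_nextRow (A r m y : ℕ) : y ≤ nextRow A r m y := by
  induction m generalizing y with
  | zero => exact le_rfl
  | succ m ih =>
    rw [nextRow_succ]
    split_ifs
    · exact (Nat.le_succ y).trans (ih _)
    · exact le_rfl

theorem row_eq_of_lt_nextRow {A r m y j : ℕ} (hy : y ≤ j) (hj : j < nextRow A r m y) :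
    row A j = r := by
  induction m generalizing y with
  | zero => exact absurd hj (by simpa [nextRow] using hy)
  | succ m ih =>
    rw [nextRow_succ] at hj
    split_ifs at hj with h
    · rcases hy.eq_or_lt with rfl | hy
      · exact h
      · exact ih hy hj
    · omega

/-- The degree of the label `i` in the graph `A`. -/
noncomputable def labelDegree (A i : ℕ) : ℕ :=
  ((Finset.range 12).filter fun j => (row A i).testBit j).card

theorem labelDegree_or_edgeBits {A p q i : ℕ} (hp : p < 12) (hq : q < 12) (hi : i < 12)
    (hpq : p ≠ q) (h₁ : (row A p).testBit q = false) (h₂ : (row A q).testBit p = false) :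
    labelDegree (A ||| edgeBits p q) i = labelDegree A i + if i = p ∨ i = q then 1 else 0 := by
  unfold labelDegree
  simp only [testBit_row_or_edgeBits hp hq hi]
  split_ifs with h
  · rcases h with rfl | rfl
    · rw [← Finset.card_insert_of_notMem (a := q) (by simp [h₁])]
      refine congrArg Finset.card (Finset.ext fun j => ?_)
      simp only [Finset.mem_filter, Finset.mem_range, Finset.mem_insert]
      grind
    · rw [← Finset.card_insert_of_notMem (a := p) (by simp [h₂])]
      refine congrArg Finset.card (Finset.ext fun j => ?_)
      simp only [Finset.mem_filter, Finset.mem_range, Finset.mem_insert]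
      grind
  · rw [add_zero]
    refine congrArg Finset.card (Finset.ext fun j => ?_)
    simp only [Finset.mem_filter, Finset.mem_range]
    grind

end Bits

section Soundness

/-- The properties of a hypothetical `2`-extendable graph on twelve vertices with at most nineteen
edges that the search relies on. -/
structure IsSparse {V : Type*} [Fintype V] (G : SimpleGraph V) : Prop where
  card : Fintype.card V = 12
  three_le : ∀ v, 3 ≤ (G.neighborSet v).ncard
  excess : ∑ v, ((G.neighborSet v).ncard - 3) ≤ 2
  triangle : ∀ a b c, G.Adj a b → G.Adj b c → ¬G.Adj a c
  exit : ∀ S : Set V, S.Nonempty → S ≠ Set.univ → ∃ a ∈ S, ∃ b ∉ S, G.Adj a b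
  extend : ∀ a b c d, G.Adj a b → G.Adj c d → a ≠ c → a ≠ d → b ≠ c → b ≠ d →
    ∃ g : V → V, (∀ v, G.Adj v (g v)) ∧ (∀ v, g (g v) = v) ∧ g a = b ∧ g c = d

/-- The labels below `n` embed the graph `A` in `G` by `f`, and the labels below `k` form an odd
cycle that is isometric enough. -/
structure IsLabelling {V : Type*} (G : SimpleGraph V) (k n A : ℕ) (f : ℕ → V) : Prop where
  le : k ≤ n
  inj : ∀ i < n, ∀ j < n, f i = f j → i = j
  adj : ∀ i < 12, ∀ j, (row A i).testBit j = true → i < n ∧ j < n ∧ G.Adj (f i) (f j)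
  symm : ∀ i < 12, ∀ j, (row A i).testBit j = true → (row A j).testBit i = true
  chordless : ∀ i < k, ∀ j < k, G.Adj (f i) (f j) → (row A i).testBit j = true
  dist : ∀ i j, i < j → j < k → ∀ v, G.Adj (f i) v → G.Adj (f j) v → j = i + 2 ∨ j + 2 = i + k
  heavy : ∀ i < k, 4 ≤ (G.neighborSet (f i)).ncard → 4 ≤ (G.neighborSet (f 0)).ncard

/-- All neighbours of the vertex labelled `i` are labelled, and their edges to `i` are in `A`. -/
def IsSaturated {V : Type*} (G : SimpleGraph V) (n A : ℕ) (f : ℕ → V) (i : ℕ) : Prop :=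
  ∀ v, G.Adj (f i) v → ∃ j < n, f j = v ∧ (row A i).testBit j = true

/-- `T2`, `T3`, `T4`, `e` record the degrees in the graph `A` on the labels below `n`. -/
structure IsDegreeRecord (n A T2 T3 T4 e : ℕ) : Prop where
  one : ∀ i < n, 1 ≤ labelDegree A i
  two : ∀ i < 12, T2.testBit i = true ↔ 2 ≤ labelDegree A i
  three : ∀ i < 12, T3.testBit i = true ↔ 3 ≤ labelDegree A i
  four : ∀ i < 12, T4.testBit i = true ↔ 4 ≤ labelDegree A i
  sum : e = ∑ i ∈ Finset.range 12, (labelDegree A i - 3)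

variable {V : Type*} {G : SimpleGraph V} {k n A T2 T3 T4 e : ℕ} {f : ℕ → V}

namespace IsLabelling

theorem le_card [Fintype V] (h : IsLabelling G k n A f) : n ≤ Fintype.card V := by
  simpa using Finset.card_le_card_of_injOn (s := Finset.range n) (t := Finset.univ) f
    (fun _ _ => Finset.mem_coe.2 (Finset.mem_univ _))
    (fun i hi j hj hij => h.inj i (by simpa using hi) j (by simpa using hj) hij)

theorem labelDegree_eq_ncard (h : IsLabelling G k n A f) (i : ℕ) (hi : i < 12) :
    labelDegree A i = (f '' {j | (row A i).testBit j = true}).ncard := by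
  rw [Set.InjOn.ncard_image, labelDegree, ← Set.ncard_coe_finset]
  · congr 1
    ext j
    simpa using lt_of_testBit_row
  · intro a ha b hb hab
    exact h.inj a (h.adj i hi a ha).2.1 b (h.adj i hi b hb).2.1 hab

theorem image_subset (h : IsLabelling G k n A f) {i : ℕ} (hi : i < 12) :
    f '' {j | (row A i).testBit j = true} ⊆ G.neighborSet (f i) := by
  rintro _ ⟨j, hj, rfl⟩
  exact (h.adj i hi j hj).2.2

theorem labelDegree_le [Finite V] (h : IsLabelling G k n A f) {i : ℕ} (hi : i < 12) :
    labelDegree A i ≤ (G.neighborSet (f i)).ncard := by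
  rw [h.labelDegree_eq_ncard i hi]
  exact Set.ncard_le_ncard (h.image_subset hi)

theorem labelDegree_eq (h : IsLabelling G k n A f) {i : ℕ} (hi : i < 12)
    (hc : IsSaturated G n A f i) : labelDegree A i = (G.neighborSet (f i)).ncard := by
  rw [h.labelDegree_eq_ncard i hi]
  congr 1
  refine (h.image_subset hi).antisymm fun v hv => ?_
  obtain ⟨j, -, hj, hij⟩ := hc v hv
  exact ⟨j, hij, hj⟩

theorem isSaturated_of_le [Finite V] (h : IsLabelling G k n A f) {i : ℕ} (hi : i < 12)
    (hc : (G.neighborSet (f i)).ncard ≤ labelDegree A i) : IsSaturated G n A f i := by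
  rw [h.labelDegree_eq_ncard i hi] at hc
  intro v hv
  have : v ∈ f '' {j | (row A i).testBit j = true} := by
    rw [Set.eq_of_subset_of_ncard_le (h.image_subset hi) hc]
    exact hv
  obtain ⟨j, hj, rfl⟩ := this
  exact ⟨j, (h.adj i hi j hj).2.1, rfl, hj⟩

theorem labelDegree_eq_zero (h : IsLabelling G k n A f) {i : ℕ} (hi : i < 12) (hn : n ≤ i) :
    labelDegree A i = 0 := by
  rw [labelDegree, Finset.card_eq_zero, Finset.filter_eq_empty_iff]
  intro j _ hj
  have := (h.adj i hi j hj).1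
  omega

theorem sum_excess_le [Fintype V] (h : IsLabelling G k n A f) (hG : IsSparse G) :
    ∑ i ∈ Finset.range n, ((G.neighborSet (f i)).ncard - 3) ≤ 2 := by
  classical
  rw [← Finset.sum_image (f := fun v => (G.neighborSet v).ncard - 3) (g := f)]
  · exact (Finset.sum_le_sum_of_subset (Finset.subset_univ _)).trans hG.excess
  · intro i hi j hj hij
    exact h.inj i (by simpa using hi) j (by simpa using hj) hij

theorem sum_range_labelDegree (h : IsLabelling G k n A f) (hn : n ≤ 12) :
    ∑ i ∈ Finset.range 12, (labelDegree A i - 3) = ∑ i ∈ Finset.range n, (labelDegree A i - 3) := by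
  symm
  refine Finset.sum_subset (by simpa using hn) fun i hi hi' => ?_
  rw [h.labelDegree_eq_zero (by simpa using hi) (by simpa using hi'), Nat.zero_sub]

theorem excess_le [Fintype V] (h : IsLabelling G k n A f) (hG : IsSparse G)
    (hr : IsDegreeRecord n A T2 T3 T4 e) : e ≤ 2 := by
  have hn := h.le_card.trans_eq hG.card
  rw [hr.sum, h.sum_range_labelDegree hn]
  refine (Finset.sum_le_sum fun i hi => ?_).trans (h.sum_excess_le hG)
  have := h.labelDegree_le (i := i) (by have := Finset.mem_range.1 hi; omega)
  omega

theorem isSaturated_of_two_le [Fintype V] (h : IsLabelling G k n A f) (hG : IsSparse G)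
    (hr : IsDegreeRecord n A T2 T3 T4 e) (he : 2 ≤ e) {i : ℕ} (hi : i < 12)
    (h3 : 3 ≤ labelDegree A i) : IsSaturated G n A f i := by
  have hn := h.le_card.trans_eq hG.card
  refine h.isSaturated_of_le hi ?_
  by_contra! hlt
  have hin : i < n := by
    by_contra! hin
    rw [h.labelDegree_eq_zero hi hin] at h3
    omega
  rw [hr.sum, h.sum_range_labelDegree hn] at he
  have := Finset.sum_lt_sum (s := Finset.range n) (f := fun i => labelDegree A i - 3)
    (g := fun i => (G.neighborSet (f i)).ncard - 3) (fun j hj => by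
      have := h.labelDegree_le (i := j) (by have := Finset.mem_range.1 hj; omega)
      omega) ⟨i, Finset.mem_range.2 hin, by omega⟩
  have := h.sum_excess_le hG
  omega

theorem or_edgeBits (h : IsLabelling G k n A f) (hn : n ≤ 12) {p q : ℕ} (hp : p < n) (hq : q < n)
    (hpq : G.Adj (f p) (f q)) : IsLabelling G k n (A ||| edgeBits p q) f where
  le := h.le
  inj := h.inj
  adj i hi j hij := by
    rw [testBit_row_or_edgeBits (by omega) (by omega) hi] at hij
    rcases hij with hij | ⟨rfl, rfl⟩ | ⟨rfl, rfl⟩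
    · exact h.adj i hi j hij
    · exact ⟨hp, hq, hpq⟩
    · exact ⟨hq, hp, hpq.symm⟩
  symm i hi j hij := by
    have hj := lt_of_testBit_row hij
    rw [testBit_row_or_edgeBits (by omega) (by omega) hi] at hij
    rw [testBit_row_or_edgeBits (by omega) (by omega) hj]
    have := h.symm i hi j
    tauto
  chordless i hi j hj hij := by
    have := h.le
    rw [testBit_row_or_edgeBits (by omega) (by omega) (by omega)]
    exact Or.inl (h.chordless i hi j hj hij)
  dist := h.dist
  heavy := h.heavy

theorem update (h : IsLabelling G k n A f) {v : V} (hv : ∀ i < n, f i ≠ v) :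
    IsLabelling G k (n + 1) A (Function.update f n v) := by
  have hf : ∀ i < n, Function.update f n v i = f i := fun i hi =>
    Function.update_of_ne hi.ne _ _
  have hle := h.le
  refine ⟨by omega, fun i hi j hj hij => ?_, fun i hi j hij => ?_, h.symm, fun i hi j hj => ?_,
    fun i j hij hj w => ?_, fun i hi => ?_⟩
  · rcases Nat.lt_succ_iff_lt_or_eq.1 hi with hi | rfl <;>
      rcases Nat.lt_succ_iff_lt_or_eq.1 hj with hj | rfl
    · exact h.inj i hi j hj (by rwa [hf i hi, hf j hj] at hij)
    · rw [hf i hi, Function.update_self] at hij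
      exact absurd hij (hv i hi)
    · rw [hf j hj, Function.update_self] at hij
      exact absurd hij.symm (hv j hj)
    · rfl
  · obtain ⟨h1, h2, h3⟩ := h.adj i hi j hij
    rw [hf i h1, hf j h2]
    exact ⟨by omega, by omega, h3⟩
  · rw [hf i (by omega), hf j (by omega)]
    exact h.chordless i hi j hj
  · rw [hf i (by omega), hf j (by omega)]
    exact h.dist i j hij hj w
  · rw [hf i (by omega), hf 0 (by omega)]
    exact h.heavy i hi

theorem swap (h : IsLabelling G k n A f) (hn : n ≤ 12) {x y : ℕ} (hx : x < n) (hy : y < n)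
    (hkx : k ≤ x) (hky : k ≤ y) (hxy : row A x = row A y) (hk : 0 < k) :
    IsLabelling G k n A (f ∘ Equiv.swap x y) ∧ ∀ i < 12, ∀ j,
      (row A i).testBit (Equiv.swap x y j) = (row A i).testBit j := by
  have hrow : ∀ i, row A (Equiv.swap x y i) = row A i := fun i => by
    by_cases hix : i = x
    · rw [hix, Equiv.swap_apply_left, hxy]
    by_cases hiy : i = y
    · rw [hiy, Equiv.swap_apply_right, hxy]
    rw [Equiv.swap_apply_of_ne_of_ne hix hiy]
  have hlt : ∀ i m, x < m → y < m → i < m → Equiv.swap x y i < m := fun i m h1 h2 h3 => by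
    rw [Equiv.swap_apply_def]
    split_ifs <;> assumption
  have hσ : ∀ i, Equiv.swap x y (Equiv.swap x y i) = i := Equiv.swap_apply_self x y
  have hlow : ∀ i < k, Equiv.swap x y i = i := fun i hi =>
    Equiv.swap_apply_of_ne_of_ne (by omega) (by omega)
  have hsymm : ∀ i < 12, ∀ j < 12, (row A i).testBit j = (row A j).testBit i := fun i hi j hj =>
    Bool.eq_iff_iff.2 ⟨h.symm i hi j, h.symm j hj i⟩
  have hcol : ∀ i < 12, ∀ j, (row A i).testBit (Equiv.swap x y j) = (row A i).testBit j := by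
    intro i hi j
    by_cases hj : j < 12
    · rw [hsymm i hi _ (hlt j 12 (by omega) (by omega) hj), hrow, hsymm i hi j hj]
    · rw [Equiv.swap_apply_of_ne_of_ne (by omega) (by omega)]
  refine ⟨⟨h.le, fun i hi j hj hij => ?_, fun i hi j hij => ?_, h.symm, fun i hi j hj => ?_,
    fun i j hij hj w => ?_, fun i hi => ?_⟩, hcol⟩
  · exact (Equiv.swap x y).injective (h.inj _ (hlt i n hx hy hi) _ (hlt j n hx hy hj) hij)
  · have := h.adj (Equiv.swap x y i) (hlt i 12 (by omega) (by omega) hi) (Equiv.swap x y j)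
      (by rwa [hrow, hcol i hi])
    refine ⟨?_, ?_, this.2.2⟩
    · simpa [hσ] using hlt _ n hx hy this.1
    · simpa [hσ] using hlt _ n hx hy this.2.1
  · simp only [Function.comp, hlow i hi, hlow j hj]
    exact h.chordless i hi j hj
  · simp only [Function.comp, hlow i (hij.trans hj), hlow j hj]
    exact h.dist i j hij hj w
  · simp only [Function.comp, hlow i hi, hlow 0 hk]
    exact h.heavy i hi

end IsLabelling

theorem sum_labelDegree_or_edgeBits {A p q : ℕ} (hp : p < 12) (hq : q < 12) (hpq : p ≠ q)
    (h₁ : (row A p).testBit q = false) (h₂ : (row A q).testBit p = false) :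
    ∑ i ∈ Finset.range 12, (labelDegree (A ||| edgeBits p q) i - 3) =
      ∑ i ∈ Finset.range 12, (labelDegree A i - 3) +
        ((if 3 ≤ labelDegree A p then 1 else 0) + if 3 ≤ labelDegree A q then 1 else 0) := by
  have key : ∀ i ∈ Finset.range 12, labelDegree (A ||| edgeBits p q) i - 3 =
      (labelDegree A i - 3) + ((if p = i then if 3 ≤ labelDegree A p then 1 else 0 else 0) +
        if q = i then if 3 ≤ labelDegree A q then 1 else 0 else 0) := by
    intro i hi
    rw [labelDegree_or_edgeBits hp hq (Finset.mem_range.1 hi) hpq h₁ h₂]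
    grind
  rw [Finset.sum_congr rfl key, Finset.sum_add_distrib, Finset.sum_add_distrib,
    Finset.sum_ite_eq, Finset.sum_ite_eq, if_pos (Finset.mem_range.2 hp),
    if_pos (Finset.mem_range.2 hq)]

theorem testBit_two_pow_iff {i p : ℕ} : (2 ^ p).testBit i = true ↔ i = p := by
  rw [Nat.testBit_two_pow, decide_eq_true_iff, eq_comm]

namespace IsDegreeRecord

theorem or_edgeBits (hr : IsDegreeRecord n A T2 T3 T4 e) (hn : n ≤ 12) {p q : ℕ} (hp : p < n)
    (hq : q < n) (hpq : p ≠ q) (h₁ : (row A p).testBit q = false)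
    (h₂ : (row A q).testBit p = false) :
    IsDegreeRecord n (A ||| edgeBits p q) (T2 ||| (2 ^ q ||| 2 ^ p))
      (T3 ||| (T2 &&& (2 ^ q ||| 2 ^ p))) (T4 ||| (T3 &&& (2 ^ q ||| 2 ^ p)))
      (e + (meets T3 (2 ^ p) + meets T3 (2 ^ q))) := by
  have hdeg : ∀ i < 12, labelDegree (A ||| edgeBits p q) i =
      labelDegree A i + if i = p ∨ i = q then 1 else 0 := fun i hi =>
    labelDegree_or_edgeBits (by omega) (by omega) hi hpq h₁ h₂
  have hp1 := hr.one p hp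
  have hq1 := hr.one q hq
  refine ⟨fun i hi => ?_, fun i hi => ?_, fun i hi => ?_, fun i hi => ?_, ?_⟩
  · rw [hdeg i (by omega)]
    exact (hr.one i hi).trans (Nat.le_add_right _ _)
  · have h2 := hr.two i hi
    simp only [hdeg i hi, Nat.testBit_or, Bool.or_eq_true, testBit_two_pow_iff]
    grind
  · have h2 := hr.two i hi
    have h3 := hr.three i hi
    simp only [hdeg i hi, Nat.testBit_or, Nat.testBit_and, Bool.or_eq_true, Bool.and_eq_true,
      testBit_two_pow_iff]
    grind
  · have h3 := hr.three i hi
    have h4 := hr.four i hi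
    simp only [hdeg i hi, Nat.testBit_or, Nat.testBit_and, Bool.or_eq_true, Bool.and_eq_true,
      testBit_two_pow_iff]
    grind
  · rw [sum_labelDegree_or_edgeBits (by omega) (by omega) hpq h₁ h₂, ← hr.sum, meets_two_pow,
      meets_two_pow]
    simp only [hr.three p (by omega), hr.three q (by omega)]

theorem or_edgeBits_new (hr : IsDegreeRecord n A T2 T3 T4 e) (hn : n < 12) {p : ℕ} (hp : p < n)
    (h₁ : (row A p).testBit n = false) (h₂ : (row A n).testBit p = false)
    (h₀ : labelDegree A n = 0) :
    IsDegreeRecord (n + 1) (A ||| edgeBits p n) (T2 ||| 2 ^ p)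
      (T3 ||| (T2 &&& 2 ^ p)) (T4 ||| (T3 &&& 2 ^ p)) (e + meets T3 (2 ^ p)) := by
  have hdeg : ∀ i < 12, labelDegree (A ||| edgeBits p n) i =
      labelDegree A i + if i = p ∨ i = n then 1 else 0 := fun i hi =>
    labelDegree_or_edgeBits (by omega) (by omega) hi (by omega) h₁ h₂
  have hp1 := hr.one p hp
  refine ⟨fun i hi => ?_, fun i hi => ?_, fun i hi => ?_, fun i hi => ?_, ?_⟩
  · rw [hdeg i (by omega)]
    have := hr.one i
    grind
  · have h2 := hr.two i hi
    simp only [hdeg i hi, Nat.testBit_or, Bool.or_eq_true, testBit_two_pow_iff]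
    grind
  · have h2 := hr.two i hi
    have h3 := hr.three i hi
    simp only [hdeg i hi, Nat.testBit_or, Nat.testBit_and, Bool.or_eq_true, Bool.and_eq_true,
      testBit_two_pow_iff]
    grind
  · have h3 := hr.three i hi
    have h4 := hr.four i hi
    simp only [hdeg i hi, Nat.testBit_or, Nat.testBit_and, Bool.or_eq_true, Bool.and_eq_true,
      testBit_two_pow_iff]
    grind
  · rw [sum_labelDegree_or_edgeBits (by omega) (by omega) (by omega) h₁ h₂, ← hr.sum,
      meets_two_pow, h₀]
    simp [hr.three p (by omega)]

end IsDegreeRecord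

/-- The vertices with labels in `mask` are matched among themselves by `g`, as far as the partners
are labelled. -/
def IsStable (n : ℕ) (f : ℕ → V) (g : V → V) (mask : ℕ) : Prop :=
  (∀ i, mask.testBit i = true → i < 12) ∧
    ∀ i < n, ∀ j < n, g (f i) = f j → mask.testBit i = true → mask.testBit j = true

theorem IsStable.remove {g : V → V} {mask i j : ℕ} (hs : IsStable n f g mask)
    (hg : ∀ v, g (g v) = v) (hf : ∀ i < n, ∀ j < n, f i = f j → i = j) (hi : i < n) (hj : j < n)
    (hij : g (f i) = f j) (hmi : mask.testBit i = true) (hne : i ≠ j) :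
    IsStable n f g ((mask ^^^ 2 ^ i) ^^^ 2 ^ j) := by
  have hmj := hs.2 i hi j hj hij hmi
  have hbit : ∀ l, ((mask ^^^ 2 ^ i) ^^^ 2 ^ j).testBit l = true ↔
      mask.testBit l = true ∧ l ≠ i ∧ l ≠ j := by
    intro l
    simp only [Nat.testBit_xor, Nat.testBit_two_pow]
    by_cases h1 : l = i
    · subst h1
      simp [hmi, hne.symm]
    by_cases h2 : l = j
    · subst h2
      simp [hmj, hne]
    simp [h1, h2, Ne.symm h1, Ne.symm h2]
  refine ⟨fun l hl => hs.1 l ((hbit l).1 hl).1, fun a ha b hb hab hma => ?_⟩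
  rw [hbit] at hma ⊢
  refine ⟨hs.2 a ha b hb hab hma.1, ?_, ?_⟩
  · rintro rfl
    refine hma.2.2 (hf _ ha _ hj ?_)
    rw [← hij, ← hab, hg]
  · rintro rfl
    refine hma.2.1 (hf _ ha _ hi ?_)
    rw [← hg (f a), hab, ← hij, hg]

theorem matchLoop_of_isStable {g : V → V} {C : ℕ} (h : IsLabelling G k n A f)
    (hadj : ∀ v, G.Adj v (g v)) (hg : ∀ v, g (g v) = v)
    (hC : ∀ i < 12, C.testBit i = true → i < n ∧ IsSaturated G n A f i) (m mask nb i j : ℕ)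
    (hs : IsStable n f g (mask ^^^ 2 ^ i)) (hi : i < n) (hj : j < n)
    (hmi : (mask ^^^ 2 ^ i).testBit i = true) (hij : g (f i) = f j) (hnb : nb.testBit j = true) :
    matchLoop A C m mask nb = true := by
  induction m generalizing mask nb i j with
  | zero => rfl
  | succ m ih =>
    have hne : i ≠ j := by
      rintro rfl
      exact G.loopless.irrefl _ (hij ▸ hadj (f i))
    rw [matchLoop_succ, if_neg (by rintro rfl; simp at hnb)]
    by_cases hp : pick nb = j
    · have hs' := hs.remove hg h.inj hi hj hij hmi hne
      rw [if_pos]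
      rw [Nat.xor_assoc mask, Nat.xor_self, Nat.xor_zero, ← hp] at hs'
      split_ifs with h0
      · rfl
      · set mk := mask ^^^ 2 ^ pick nb
        set v := pick (mk &&& C)
        have hv := testBit_pick h0
        rw [Nat.testBit_and, Bool.and_eq_true] at hv
        obtain ⟨hvn, hsat⟩ := hC v (hs'.1 v hv.1) hv.2
        obtain ⟨w, hw, hvw, hbit⟩ := hsat _ (hadj (f v))
        have hx : mk ^^^ 2 ^ v ^^^ 2 ^ v = mk := by rw [Nat.xor_assoc, Nat.xor_self, Nat.xor_zero]
        refine ih _ _ v w (by rwa [hx]) hvn hw (by rw [hx]; exact hv.1) hvw.symm ?_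
        rw [Nat.testBit_and, hbit, hs'.2 v hvn w hw hvw.symm hv.1]
        rfl
    · have hrest : matchLoop A C m mask (nb ^^^ 2 ^ pick nb) = true := by
        refine ih mask _ i j hs hi hj hmi hij ?_
        rw [Nat.testBit_xor, hnb, Nat.testBit_two_pow, decide_eq_false hp]
        rfl
      rw [hrest, ite_self]

theorem canMatch_of_isStable {g : V → V} {C mk : ℕ} (h : IsLabelling G k n A f)
    (hadj : ∀ v, G.Adj v (g v)) (hg : ∀ v, g (g v) = v)
    (hC : ∀ i < 12, C.testBit i = true → i < n ∧ IsSaturated G n A f i)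
    (hs : IsStable n f g mk) : canMatch A C mk = true := by
  rw [canMatch_eq]
  split_ifs with h0
  · rfl
  · set v := pick (mk &&& C)
    have hv := testBit_pick h0
    rw [Nat.testBit_and, Bool.and_eq_true] at hv
    obtain ⟨hvn, hsat⟩ := hC v (hs.1 v hv.1) hv.2
    obtain ⟨w, hw, hvw, hbit⟩ := hsat _ (hadj (f v))
    have hx : mk ^^^ 2 ^ v ^^^ 2 ^ v = mk := by rw [Nat.xor_assoc, Nat.xor_self, Nat.xor_zero]
    refine matchLoop_of_isStable h hadj hg hC _ _ _ v w (by rwa [hx]) hvn hw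
      (by rw [hx]; exact hv.1) hvw.symm ?_
    rw [Nat.testBit_and, hbit, hs.2 v hvn w hw hvw.symm hv.1]
    rfl

theorem testBit_row_of_and_eq {A m p q : ℕ} (hq : q < 12) (h : A &&& m = m)
    (hm : m.testBit (132 - 12 * p + q) = true) : (row A p).testBit q = true := by
  rw [← h, Nat.testBit_and, Bool.and_eq_true] at hm
  rw [testBit_row, hm.1, decide_eq_true hq]
  rfl

/-- The list consists of pairs of disjoint edges on the labels below twelve. -/
def IsPairList (L : List (ℕ × ℕ × ℕ × ℕ)) : Prop :=
  ∀ t ∈ L, t.1 < 12 ∧ t.2.1 < 12 ∧ t.2.2.1 < 12 ∧ t.2.2.2 < 12 ∧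
    t.1 ≠ t.2.2.1 ∧ t.1 ≠ t.2.2.2 ∧ t.2.1 ≠ t.2.2.1 ∧ t.2.1 ≠ t.2.2.2

theorem testAll_of_isSparse [Fintype V] (hG : IsSparse G) (h : IsLabelling G k n A f) {C : ℕ}
    (hC : ∀ i < 12, C.testBit i = true → i < n ∧ IsSaturated G n A f i)
    {L : List (ℕ × ℕ × ℕ × ℕ)} (hL : IsPairList L) : testAll A C L = true := by
  induction L with
  | nil => rfl
  | cons t L ih =>
    obtain ⟨a, b, c, d⟩ := t
    obtain ⟨ha, hb, hc, hd, hac, had, hbc, hbd⟩ := hL _ List.mem_cons_self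
    dsimp only at ha hb hc hd hac had hbc hbd
    rw [testAll_cons, ih fun t ht => hL t (List.mem_cons_of_mem _ ht), Bool.and_true]
    split_ifs with hm
    · have h₁ := h.adj a ha b (testBit_row_of_and_eq hb hm (by
        rw [Nat.testBit_or, Bool.or_eq_true, testBit_edgeBits ha hb ha hb]; simp))
      have h₂ := h.adj c hc d (testBit_row_of_and_eq hd hm (by
        rw [Nat.testBit_or, Bool.or_eq_true, testBit_edgeBits hc hd hc hd]; simp))
      have hne : ∀ i < n, ∀ j < n, i ≠ j → f i ≠ f j := fun i hi j hj hij hf =>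
        hij (h.inj i hi j hj hf)
      obtain ⟨g, hadj, hg, hab, hcd⟩ := hG.extend _ _ _ _ h₁.2.2 h₂.2.2
        (hne a h₁.1 c h₂.1 hac) (hne a h₁.1 d h₂.2.1 had) (hne b h₁.2.1 c h₂.1 hbc)
        (hne b h₁.2.1 d h₂.2.1 hbd)
      have hbit : ∀ i, ((4095 ^^^ (2 ^ a ||| 2 ^ b)) ^^^ (2 ^ c ||| 2 ^ d)).testBit i = true ↔
          i < 12 ∧ i ≠ a ∧ i ≠ b ∧ i ≠ c ∧ i ≠ d := by
        intro i
        rw [show 4095 = 2 ^ 12 - 1 from rfl]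
        simp only [Nat.testBit_xor, Nat.testBit_or, Nat.testBit_two_pow,
          Nat.testBit_two_pow_sub_one]
        grind
      refine canMatch_of_isStable h hadj hg hC ⟨fun i hi => ((hbit i).1 hi).1, ?_⟩
      intro i hi j hj hij hmi
      have hn := h.le_card.trans_eq hG.card
      have hinj : ∀ p q, q < n → g (f p) = f q → j = p → i = q := by
        rintro p q hq hpq rfl
        refine h.inj i hi q hq ?_
        rw [← hpq, ← hij, hg]
      rw [hbit] at hmi ⊢
      refine ⟨by omega, fun hj => hmi.2.2.1 (hinj a b h₁.2.1 hab hj),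
        fun hj => hmi.2.1 (hinj b a h₁.1 (by rw [← hab, hg]) hj),
        fun hj => hmi.2.2.2.2 (hinj c d h₂.2.1 hcd hj),
        fun hj => hmi.2.2.2.1 (hinj d c h₂.1 (by rw [← hcd, hg]) hj)⟩
    · rfl

/-- The invariant of the search. -/
structure IsSearchState {V : Type*} (G : SimpleGraph V) (k n d x A : ℕ) (f : ℕ → V) : Prop
    extends IsLabelling G k n A f where
  lt : d < x
  le_x : k ≤ x
  d_le : d ≤ n
  saturated : ∀ i < d, IsSaturated G n A f i
  decided : d < n → ∀ j < x, j < n → G.Adj (f d) (f j) → (row A d).testBit j = true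
  old : ∀ i < 12, ∀ j, d < i → d < j → (row A i).testBit j = true → i < k ∧ j < k
  recent : d < n → ∀ j, (row A d).testBit j = true → j < x

theorem IsSaturated.or_edgeBits {i p q : ℕ} (h : IsSaturated G n A f i) (hi : i < 12) (hp : p < 12)
    (hq : q < 12) : IsSaturated G n (A ||| edgeBits p q) f i := by
  intro v hv
  obtain ⟨j, hj, hfj, hbit⟩ := h v hv
  exact ⟨j, hj, hfj, (testBit_row_or_edgeBits hp hq hi).2 (Or.inl hbit)⟩

namespace IsSearchState

variable {d x : ℕ}

theorem adjacent (h : IsSearchState G k n d x A f) (hn : n ≤ 12) (hx : x < n)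
    (hadj : G.Adj (f d) (f x)) : IsSearchState G k n d (x + 1) (A ||| edgeBits d x) f where
  toIsLabelling := h.or_edgeBits hn (h.lt.trans hx) hx hadj
  lt := h.lt.trans (Nat.lt_succ_self x)
  le_x := h.le_x.trans (Nat.le_succ x)
  d_le := h.d_le
  saturated i hi := (h.saturated i hi).or_edgeBits (by have := h.d_le; omega)
    (by have := h.lt; omega) (by omega)
  decided hdn j hj hjn hdj := by
    have := h.lt
    rw [testBit_row_or_edgeBits (by omega) (by omega) (by omega)]
    rcases Nat.lt_succ_iff_lt_or_eq.1 hj with hj | rfl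
    · exact Or.inl (h.decided hdn j hj hjn hdj)
    · simp
  old i hi j hdi hdj hij := by
    have := h.lt
    rw [testBit_row_or_edgeBits (by omega) (by omega) hi] at hij
    rcases hij with hij | hij
    · exact h.old i hi j hdi hdj hij
    · omega
  recent hdn j hj := by
    have := h.lt
    rw [testBit_row_or_edgeBits (by omega) (by omega) (by omega)] at hj
    rcases hj with hj | hj
    · have := h.recent hdn j hj
      omega
    · omega

theorem skip (h : IsSearchState G k n d x A f) {y : ℕ} (hxy : x ≤ y)
    (hdec : ∀ j, x ≤ j → j < y → j < n → ¬G.Adj (f d) (f j)) :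
    IsSearchState G k n d y A f where
  toIsLabelling := h.toIsLabelling
  lt := h.lt.trans_le hxy
  le_x := h.le_x.trans hxy
  d_le := h.d_le
  saturated := h.saturated
  decided hdn j hj hjn hdj := by
    by_cases hjx : j < x
    · exact h.decided hdn j hjx hjn hdj
    · exact absurd hdj (hdec j (by omega) hj hjn)
  old := h.old
  recent hdn j hj := (h.recent hdn j hj).trans_le hxy

theorem swapped (h : IsSearchState G k n d x A f) (hn : n ≤ 12) (hk : 0 < k) {y : ℕ} (hxy : x ≤ y)
    (hy : y < n) (hrow : row A x = row A y) :
    IsSearchState G k n d x A (f ∘ Equiv.swap x y) := by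
  have hlt := h.lt
  have hkx := h.le_x
  obtain ⟨hl, hcol⟩ := h.swap hn (hxy.trans_lt hy) hy hkx (hkx.trans hxy) hrow hk
  have hlow : ∀ i < x, Equiv.swap x y i = i := fun i hi =>
    Equiv.swap_apply_of_ne_of_ne (by omega) (by omega)
  refine ⟨hl, hlt, hkx, h.d_le, fun i hi v hv => ?_, fun hdn j hj hjn hdj => ?_, h.old, h.recent⟩
  · simp only [Function.comp, hlow i (by omega)] at hv
    obtain ⟨j, hj, rfl, hij⟩ := h.saturated i hi v hv
    refine ⟨Equiv.swap x y j, ?_, by simp, by rwa [hcol i (by omega)]⟩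
    rw [Equiv.swap_apply_def]
    split_ifs <;> omega
  · simp only [Function.comp, hlow d hlt, hlow j hj] at hdj
    exact h.decided hdn j hj hjn hdj

theorem next (h : IsSearchState G k n d x A f) (hd : d < n) (hn : n ≤ 12)
    (hsat : IsSaturated G n A f d) :
    IsSearchState G k n (d + 1) (if k ≤ d + 1 then d + 2 else k) A f where
  toIsLabelling := h.toIsLabelling
  lt := by split_ifs <;> omega
  le_x := by split_ifs <;> omega
  d_le := hd
  saturated i hi := by
    rcases Nat.lt_succ_iff_lt_or_eq.1 hi with hi | rfl
    · exact h.saturated i hi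
    · exact hsat
  decided hdn j hj hjn hdj := by
    by_cases hk : d + 1 < k
    · rw [if_neg (by omega)] at hj
      exact h.chordless _ hk j hj hdj
    · rw [if_pos (by omega)] at hj
      have hne : j ≠ d + 1 := by
        rintro rfl
        exact G.loopless.irrefl _ hdj
      have hsat' : IsSaturated G n A f j := by
        rcases Nat.lt_succ_iff_lt_or_eq.1 (show j < d + 1 by omega) with hj | rfl
        · exact h.saturated j hj
        · exact hsat
      obtain ⟨i, hi, hfi, hbit⟩ := hsat' _ hdj.symm
      have hij : d + 1 = i := h.inj _ hdn _ hi hfi.symm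
      exact h.symm j (by omega) _ (hij ▸ hbit)
  old i hi j hdi hdj := h.old i hi j (by omega) (by omega)
  recent hdn j hj := by
    have hle := h.le
    by_contra hc
    have := h.old (d + 1) (by omega) j (by omega) (by split_ifs at hc <;> omega) hj
    split_ifs at hc <;> omega

theorem fresh (h : IsSearchState G k n d x A f) (hd : d < n) (hn : n < 12) (hx : n ≤ x) {v : V}
    (hv : ∀ i < n, f i ≠ v) (hadj : G.Adj (f d) v) :
    IsSearchState G k (n + 1) d (n + 1) (A ||| edgeBits d n) (Function.update f n v) := by
  have hf : ∀ i < n, Function.update f n v i = f i := fun i hi =>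
    Function.update_of_ne hi.ne _ _
  have hle := h.le
  refine ⟨(h.update hv).or_edgeBits (by omega) (by omega) (by omega) ?_, by omega, by omega,
    by omega, fun i hi w hw => ?_, fun hdn j hj hjn hdj => ?_, fun i hi j hdi hdj hij => ?_,
    fun hdn j hj => ?_⟩
  · rwa [hf d hd, Function.update_self]
  · rw [hf i (by omega)] at hw
    obtain ⟨j, hj, hfj, hbit⟩ := h.saturated i hi w hw
    exact ⟨j, by omega, by rwa [hf j hj],
      (testBit_row_or_edgeBits (by omega) hn (by omega)).2 (Or.inl hbit)⟩
  · rw [testBit_row_or_edgeBits (by omega) hn (by omega)]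
    rcases Nat.lt_succ_iff_lt_or_eq.1 hj with hj | rfl
    · rw [hf d hd, hf j hj] at hdj
      exact Or.inl (h.decided hd j (by omega) hj hdj)
    · simp
  · rw [testBit_row_or_edgeBits (by omega) hn hi] at hij
    rcases hij with hij | hij
    · exact h.old i hi j hdi hdj hij
    · omega
  · rw [testBit_row_or_edgeBits (by omega) hn (by omega)] at hj
    rcases hj with hj | hj
    · have := (h.adj d (by omega) j hj).2.1
      omega
    · omega

theorem lt_of_isSparse [Fintype V] (hG : IsSparse G) (h : IsSearchState G k n n x A f)
    (hk : 0 < k) : 12 ≤ n := by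
  by_contra! hn
  have hle := h.le
  obtain ⟨a, ⟨i, hi, rfl⟩, b, hb, hab⟩ := hG.exit (f '' Set.Iio n) ⟨f 0, 0, by simp; omega, rfl⟩ (by
    intro hS
    have h1 := Set.ncard_image_le (f := f) (Set.finite_Iio n)
    rw [hS, Set.ncard_univ, Nat.card_eq_fintype_card, hG.card, ← Finset.coe_Iio,
      Set.ncard_coe_finset, Nat.card_Iio] at h1
    omega)
  obtain ⟨j, hj, hfj, -⟩ := h.saturated i hi b hab
  exact hb ⟨j, hj, hfj⟩

theorem row_and_eq_zero [Fintype V] (hG : IsSparse G) (h : IsSearchState G k n d x A f)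
    (hx : x < n) (hadj : G.Adj (f d) (f x)) : row A x &&& (row A d ||| far k d) = 0 := by
  have hn := h.le_card.trans_eq hG.card
  have hlt := h.lt
  by_contra h0
  obtain ⟨i, h1, h2⟩ := exists_testBit_of_and_ne_zero h0
  have hxi := (h.adj x (by omega) i h1).2.2
  rw [Nat.testBit_or, Bool.or_eq_true] at h2
  rcases h2 with h2 | h2
  · exact hG.triangle _ _ _ hadj hxi (h.adj d (by omega) i h2).2.2
  · obtain ⟨hdk, hid, h3, h4⟩ := testBit_far (by omega) h2
    have := h.dist i d hid hdk _ hxi.symm hadj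
    omega

end IsSearchState

theorem not_search [Fintype V] (hG : IsSparse G) (hk : 0 < k) {L : List (ℕ × ℕ × ℕ × ℕ)}
    (hL : IsPairList L) {m n d x A T2 T3 T4 e : ℕ}
    (hs : search k L m n d x A T2 T3 T4 e = true) {f : ℕ → V}
    (h : IsSearchState G k n d x A f) (hr : IsDegreeRecord n A T2 T3 T4 e) : False := by
  induction m generalizing n d x A T2 T3 T4 e f with
  | zero => exact Bool.false_ne_true hs
  | succ m ih =>
    have hn := h.le_card.trans_eq hG.card
    rw [search_succ] at hs
    by_cases hdn : d = n
    · subst hdn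
      rw [if_pos rfl] at hs
      have := h.lt_of_isSparse hG hk
      omega
    rw [if_neg hdn] at hs
    by_cases hxn : x < n
    · rw [if_pos hxn] at hs
      have hlt := h.lt
      have hno : ∀ f : ℕ → V, IsSearchState G k n d x A f → ¬G.Adj (f d) (f x) := by
        intro f h hadj
        have hdx : (row A d).testBit x = false := by
          by_contra hc
          have := h.recent (by omega) x (by simpa using hc)
          omega
        have hxd : (row A x).testBit d = false := by
          by_contra hc
          rw [h.symm x (by omega) d (by simpa using hc)] at hdx
          exact Bool.false_ne_true hdx.symm
        have h' := h.adjacent hn hxn hadj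
        have hr' := hr.or_edgeBits hn (by omega) hxn (by omega) hdx hxd
        exact ih (hs.1 (h.row_and_eq_zero hG hxn hadj) (h'.excess_le hG hr')) h' hr'
      refine ih hs.2 (h.skip ((Nat.le_succ x).trans (le_nextRow _ _ _ _)) ?_) hr
      intro j hxj hj hjn hdj
      have hrow : row A x = row A j := by
        rcases hxj.eq_or_lt with rfl | hxj
        · rfl
        · exact (row_eq_of_lt_nextRow hxj hj).symm
      refine hno _ (h.swapped hn hk hxj hjn hrow) ?_
      simpa [Equiv.swap_apply_of_ne_of_ne hlt.ne (hlt.trans_le hxj).ne] using hdj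
    · rw [if_neg hxn] at hs
      have hdn' : d < n := lt_of_le_of_ne h.d_le hdn
      by_cases hfresh : ∃ v, G.Adj (f d) v ∧ ∀ i < n, f i ≠ v
      · obtain ⟨v, hdv, hv⟩ := hfresh
        have hn' : n < 12 := by
          have := (h.update hv).le_card
          rw [hG.card] at this
          omega
        have h' := h.fresh hdn' hn' (by omega) hv hdv
        have hdnbit : (row A d).testBit n = false := by
          by_contra hc
          have := (h.adj d (by omega) n (by simpa using hc)).2.1
          omega
        have hndbit : (row A n).testBit d = false := by
          by_contra hc
          have := (h.adj n hn' d (by simpa using hc)).1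
          omega
        have hr' := hr.or_edgeBits_new hn' hdn' hdnbit hndbit
          (h.labelDegree_eq_zero hn' le_rfl)
        exact ih (hs.2 hn' (h'.excess_le hG hr')) h' hr'
      · push Not at hfresh
        have hsat : IsSaturated G n A f d := by
          intro v hv
          obtain ⟨i, hi, rfl⟩ := hfresh v hv
          exact ⟨i, hi, rfl, h.decided hdn' i (by omega) hi hv⟩
        have hdeg := h.labelDegree_eq (by omega) hsat
        have h' := h.next hdn' hn hsat
        refine ih (hs.1 ?_ ?_ ?_) h' hr
        · rw [and_two_pow_ne_zero, hr.three d (by omega), hdeg]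
          exact hG.three_le _
        · intro hdk h4
          rw [and_two_pow_ne_zero, hr.four d (by omega), hdeg] at h4
          change T4 &&& 2 ^ 0 ≠ 0
          rw [and_two_pow_ne_zero, hr.four 0 (by omega),
            h.labelDegree_eq (by omega) (h'.saturated 0 (by omega))]
          exact h.heavy d hdk h4
        · intro _
          refine testAll_of_isSparse hG h.toIsLabelling (fun i hi hC => ?_) hL
          rw [Nat.testBit_or, Bool.or_eq_true, Nat.testBit_two_pow_sub_one,
            decide_eq_true_iff] at hC
          rcases hC with hC | hC
          · exact ⟨by omega, h'.saturated i hC⟩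
          · split_ifs at hC with he
            · rw [hr.three i hi] at hC
              refine ⟨?_, h.isSaturated_of_two_le hG hr he hi hC⟩
              by_contra! hin
              rw [h.labelDegree_eq_zero hi hin] at hC
              omega
            · simp at hC

end Soundness

section Start

theorem testBit_row_cycleBits {k : ℕ} (hk : k = 5 ∨ k = 7 ∨ k = 9 ∨ k = 11) :
    ∀ i < 12, ∀ j < 12, (row (cycleBits k k) i).testBit j =
      decide (i < k ∧ j < k ∧ ((i + 1) % k = j ∨ (j + 1) % k = i)) := by
  rcases hk with rfl | rfl | rfl | rfl <;> decide +kernel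

theorem labelDegree_cycleBits {k : ℕ} (hk : k = 5 ∨ k = 7 ∨ k = 9 ∨ k = 11) :
    ∀ i < 12, labelDegree (cycleBits k k) i = if i < k then 2 else 0 := by
  rcases hk with rfl | rfl | rfl | rfl <;> decide +kernel

theorem isPairList_testsFive : IsPairList testsFive := by
  unfold IsPairList testsFive
  decide +kernel

theorem isPairList_testsSeven : IsPairList testsSeven := by
  unfold IsPairList testsSeven
  decide +kernel

theorem searchFrom_eq (k : ℕ) (L : List (ℕ × ℕ × ℕ × ℕ)) :
    searchFrom k L = search k L 300 k 0 k (cycleBits k k) (2 ^ k - 1) 0 0 0 := by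
  rw [searchFrom, force_eq]
  rfl

theorem isDegreeRecord_cycleBits {k : ℕ} (hk : k = 5 ∨ k = 7 ∨ k = 9 ∨ k = 11) :
    IsDegreeRecord k (cycleBits k k) (2 ^ k - 1) 0 0 0 := by
  have hdeg := labelDegree_cycleBits hk
  have hle : k ≤ 12 := by omega
  refine ⟨fun i hi => ?_, fun i hi => ?_, fun i hi => ?_, fun i hi => ?_, ?_⟩
  · rw [hdeg i (by omega), if_pos hi]
    decide
  · rw [hdeg i hi, Nat.testBit_two_pow_sub_one, decide_eq_true_iff]
    split_ifs <;> omega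
  · rw [hdeg i hi, Nat.zero_testBit]
    split_ifs <;> simp
  · rw [hdeg i hi, Nat.zero_testBit]
    split_ifs <;> simp
  · refine (Finset.sum_eq_zero fun i hi => ?_).symm
    rw [hdeg i (Finset.mem_range.1 hi)]
    split_ifs <;> rfl

theorem not_searchFrom {V : Type*} [Fintype V] {G : SimpleGraph V} (hG : IsSparse G) {k : ℕ}
    (hk : k = 5 ∨ k = 7 ∨ k = 9 ∨ k = 11) {L : List (ℕ × ℕ × ℕ × ℕ)} (hL : IsPairList L)
    (hs : searchFrom k L = true) {c : ℕ → V} (hinj : ∀ i < k, ∀ j < k, c i = c j → i = j)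
    (hadj : ∀ i < k, ∀ j < k, G.Adj (c i) (c j) ↔ (i + 1) % k = j ∨ (j + 1) % k = i)
    (hdist : ∀ i j, i < j → j < k → ∀ v, G.Adj (c i) v → G.Adj (c j) v → j = i + 2 ∨ j + 2 = i + k)
    (hheavy : ∀ i < k, 4 ≤ (G.neighborSet (c i)).ncard → 4 ≤ (G.neighborSet (c 0)).ncard) :
    False := by
  have hbit : ∀ i < 12, ∀ j, (row (cycleBits k k) i).testBit j = true ↔
      i < k ∧ j < k ∧ G.Adj (c i) (c j) := by
    intro i hi j
    constructor
    · intro h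
      rw [testBit_row_cycleBits hk i hi j (lt_of_testBit_row h), decide_eq_true_iff] at h
      exact ⟨h.1, h.2.1, (hadj i h.1 j h.2.1).2 h.2.2⟩
    · rintro ⟨h1, h2, h3⟩
      rw [testBit_row_cycleBits hk i hi j (by omega), decide_eq_true_iff]
      exact ⟨h1, h2, (hadj i h1 j h2).1 h3⟩
  rw [searchFrom_eq] at hs
  refine not_search hG (by omega) hL hs (f := c)
    ⟨⟨le_rfl, hinj, fun i hi j => (hbit i hi j).1, fun i hi j hij => ?_, fun i hi j hj hij =>
      (hbit i (by omega) j).2 ⟨hi, hj, hij⟩, hdist, hheavy⟩, by omega, le_rfl, Nat.zero_le _,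
      fun i hi => absurd hi (Nat.not_lt_zero i), fun _ j hj _ hij =>
        (hbit 0 (by omega) j).2 ⟨by omega, hj, hij⟩, fun i hi j _ _ hij =>
        ⟨((hbit i hi j).1 hij).1, ((hbit i hi j).1 hij).2.1⟩, fun _ j hj =>
        ((hbit 0 (by omega) j).1 hj).2.1⟩ (isDegreeRecord_cycleBits hk)
  have := (hbit i hi j).1 hij
  exact (hbit j (by omega) i).2 ⟨this.2.1, this.1, this.2.2.symm⟩

end Start

section OddCycle

variable {V : Type*} {G : SimpleGraph V}

theorem exists_odd_closed_walk (hG : G.Connected) (hc : ¬G.Colorable 2) :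
    ∃ n, Odd n ∧ ∃ u, ∃ w : G.Walk u u, w.length = n := by
  by_contra! hw
  obtain ⟨r⟩ := hG.nonempty
  refine hc ((SimpleGraph.Coloring.mk (fun v => (G.dist r v : ZMod 2)) ?_).colorable)
  intro a b hab he
  obtain ⟨p, hp⟩ := hG.exists_walk_length_eq_dist r a
  obtain ⟨q, hq⟩ := hG.exists_walk_length_eq_dist r b
  refine hw _ ?_ r ((p.concat hab).append q.reverse) rfl
  have := (ZMod.natCast_eq_natCast_iff' _ _ _).1 he
  rw [Walk.length_append, Walk.length_concat, Walk.length_reverse, hp, hq, Nat.odd_iff]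
  omega

theorem exists_walk_of_adj_succ {c : ℕ → V} (hc : ∀ i, G.Adj (c i) (c (i + 1))) (i n : ℕ) :
    ∃ w : G.Walk (c i) (c (i + n)), w.length = n := by
  induction n with
  | zero => exact ⟨Walk.nil, rfl⟩
  | succ n ih =>
    obtain ⟨w, hw⟩ := ih
    exact ⟨w.concat (hc (i + n)), by rw [Walk.length_concat, hw]⟩

theorem exists_shortest_odd_cycle (hG : G.Connected) (hc : ¬G.Colorable 2) :
    ∃ k, Odd k ∧ (∀ n, Odd n → ∀ u, ∀ w : G.Walk u u, w.length = n → k ≤ n) ∧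
      ∃ c : ℕ → V, (∀ i, G.Adj (c i) (c (i + 1))) ∧ ∀ i, c (i + k) = c i := by
  classical
  have h := exists_odd_closed_walk hG hc
  obtain ⟨hk, u, w, hw⟩ := Nat.find_spec h
  refine ⟨Nat.find h, hk, fun n hn u w hw => Nat.find_min' h ⟨hn, u, w, hw⟩, ?_⟩
  generalize Nat.find h = k at *
  have hpos := hk.pos
  refine ⟨fun i => w.getVert (i % k), fun i => ?_, fun i => by simp⟩
  have hlt := Nat.mod_lt i hpos
  have hadj := w.adj_getVert_succ (i := i % k) (by omega)
  rcases Nat.lt_or_ge (i % k + 1) k with h1 | h1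
  · rwa [← Nat.mod_eq_of_lt h1, Nat.mod_add_mod] at hadj
  · have h2 : i % k + 1 = k := by omega
    have h3 : (i + 1) % k = 0 := by rw [← Nat.mod_add_mod, h2, Nat.mod_self]
    rw [h2, ← hw, Walk.getVert_length] at hadj
    simpa [h3, hw] using hadj

variable {k : ℕ} {c : ℕ → V}

theorem length_of_walk_between (hk : Odd k)
    (hmin : ∀ n, Odd n → ∀ u, ∀ w : G.Walk u u, w.length = n → k ≤ n)
    (hadj : ∀ i, G.Adj (c i) (c (i + 1))) (hper : ∀ i, c (i + k) = c i)
    {i j : ℕ} (hij : i < j) (hj : j < k) (p : G.Walk (c i) (c j)) :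
    (Odd (p.length + (j - i)) ∧ k ≤ p.length + (j - i)) ∨
      (Even (p.length + (j - i)) ∧ j - i ≤ p.length) := by
  rcases Nat.even_or_odd (p.length + (j - i)) with he | ho
  · obtain ⟨q, hq⟩ := exists_walk_of_adj_succ hadj j (i + k - j)
    have hend : c (j + (i + k - j)) = c i := by rw [← hper i]; congr 1; omega
    have := hmin (p.length + (i + k - j)) (by
      rw [Nat.odd_iff] at *; rw [Nat.even_iff] at he; omega) _
      (p.append (q.copy rfl hend)) (by simp [hq])
    exact Or.inr ⟨he, by omega⟩
  · obtain ⟨q, hq⟩ := exists_walk_of_adj_succ hadj i (j - i)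
    have hend : c (i + (j - i)) = c j := by congr 1; omega
    exact Or.inl ⟨ho, hmin _ ho _ (p.append (q.copy rfl hend).reverse) (by simp [hq])⟩

theorem shortest_odd_cycle_injOn (hk : Odd k)
    (hmin : ∀ n, Odd n → ∀ u, ∀ w : G.Walk u u, w.length = n → k ≤ n)
    (hadj : ∀ i, G.Adj (c i) (c (i + 1))) (hper : ∀ i, c (i + k) = c i) :
    ∀ i < k, ∀ j < k, c i = c j → i = j := by
  have key : ∀ i j, i < j → j < k → c i ≠ c j := fun i j hij hj he => by
    rcases length_of_walk_between hk hmin hadj hper hij hj (Walk.nil.copy rfl he) with h | h <;>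
      simp only [Walk.length_copy, Walk.length_nil] at h <;> omega
  intro i hi j hj he
  rcases lt_trichotomy i j with h | h | h
  · exact absurd he (key i j h hj)
  · exact h
  · exact absurd he.symm (key j i h hi)

theorem shortest_odd_cycle_adj_iff (hk : Odd k)
    (hmin : ∀ n, Odd n → ∀ u, ∀ w : G.Walk u u, w.length = n → k ≤ n)
    (hadj : ∀ i, G.Adj (c i) (c (i + 1))) (hper : ∀ i, c (i + k) = c i) :
    ∀ i < k, ∀ j < k, G.Adj (c i) (c j) ↔ (i + 1) % k = j ∨ (j + 1) % k = i := by
  have key : ∀ i j, i < j → j < k → G.Adj (c i) (c j) → (i + 1) % k = j ∨ (j + 1) % k = i := by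
    intro i j hij hj h
    have := length_of_walk_between hk hmin hadj hper hij hj h.toWalk
    simp only [Walk.length_cons, Walk.length_nil, Nat.odd_iff, Nat.even_iff] at this
    rcases this with h | h
    · right
      rw [show j + 1 = k by omega, Nat.mod_self]; omega
    · left
      rw [Nat.mod_eq_of_lt] <;> omega
  have step : ∀ i < k, G.Adj (c i) (c ((i + 1) % k)) := fun i hi => by
    rcases Nat.lt_or_ge (i + 1) k with h | h
    · rw [Nat.mod_eq_of_lt h]; exact hadj i
    · have h := hadj i
      rw [show i + 1 = k by omega, Nat.mod_self]
      rw [show i + 1 = 0 + k by omega, hper] at h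
      exact h
  intro i hi j hj
  constructor
  · intro h
    rcases lt_trichotomy i j with hij | rfl | hij
    · exact key i j hij hj h
    · exact absurd h (G.loopless.irrefl _)
    · exact (key j i hij hi h.symm).symm
  · rintro (rfl | rfl)
    · exact step i hi
    · exact (step j hj).symm

theorem shortest_odd_cycle_common_neighbor (hk : Odd k)
    (hmin : ∀ n, Odd n → ∀ u, ∀ w : G.Walk u u, w.length = n → k ≤ n)
    (hadj : ∀ i, G.Adj (c i) (c (i + 1))) (hper : ∀ i, c (i + k) = c i) :
    ∀ i j, i < j → j < k → ∀ v, G.Adj (c i) v → G.Adj (c j) v → j = i + 2 ∨ j + 2 = i + k := by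
  intro i j hij hj v hi hv
  have := length_of_walk_between hk hmin hadj hper hij hj (hi.toWalk.append hv.symm.toWalk)
  simp only [Walk.length_append, Walk.length_cons, Walk.length_nil, Nat.odd_iff,
    Nat.even_iff] at this
  rw [Nat.odd_iff] at hk
  omega

end OddCycle

theorem IsSparse.colorable_two {V : Type*} [Fintype V] {G : SimpleGraph V} (hG : IsSparse G)
    (hconn : G.Connected) : G.Colorable 2 := by
  by_contra hc
  obtain ⟨k, hk, hmin, c₀, hadj₀, hper₀⟩ := exists_shortest_odd_cycle hconn hc
  obtain ⟨c, hadj, hper, hheavy⟩ : ∃ c : ℕ → V, (∀ i, G.Adj (c i) (c (i + 1))) ∧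
      (∀ i, c (i + k) = c i) ∧
      ∀ i < k, 4 ≤ (G.neighborSet (c i)).ncard → 4 ≤ (G.neighborSet (c 0)).ncard := by
    by_cases h : ∃ s, 4 ≤ (G.neighborSet (c₀ s)).ncard
    · obtain ⟨s, hs⟩ := h
      exact ⟨fun i => c₀ (s + i), fun i => hadj₀ (s + i),
        fun i => (congrArg c₀ (add_assoc s i k).symm).trans (hper₀ (s + i)),
        fun _ _ _ => hs⟩
    · exact ⟨c₀, hadj₀, hper₀, fun i _ hi => absurd ⟨i, hi⟩ h⟩
  have hinj := shortest_odd_cycle_injOn hk hmin hadj hper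
  have hle : k ≤ 12 := by
    have := Fintype.card_le_of_injective (fun i : Fin k => c i)
      fun i j h => Fin.ext (hinj i i.2 j j.2 h)
    rwa [Fintype.card_fin, hG.card] at this
  have hk1 : k ≠ 1 := by
    rintro rfl
    exact (hadj 0).ne (hper 0).symm
  have hk3 : k ≠ 3 := by
    rintro rfl
    have h := hadj 2
    rw [show 2 + 1 = 0 + 3 from rfl, hper] at h
    exact hG.triangle _ _ _ (hadj 0) (hadj 1) h.symm
  have hcases : k = 5 ∨ k = 7 ∨ k = 9 ∨ k = 11 := by
    rw [Nat.odd_iff] at hk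
    omega
  have key {L} (hL : IsPairList L) (hs : searchFrom k L = true) : False :=
    not_searchFrom hG hcases hL hs hinj
      (shortest_odd_cycle_adj_iff hk hmin hadj hper)
      (shortest_odd_cycle_common_neighbor hk hmin hadj hper) hheavy
  rcases hcases with rfl | rfl | rfl | rfl
  · exact key isPairList_testsFive searchFrom_five
  · exact key isPairList_testsSeven searchFrom_seven
  · exact key (by simp [IsPairList]) searchFrom_nine
  · exact key (by simp [IsPairList]) searchFrom_eleven

section Extendable

variable {V : Type*} {G : SimpleGraph V}

theorem SimpleGraph.Subgraph.IsPerfectMatching.exists_involution {P : G.Subgraph}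
    (hP : P.IsPerfectMatching) :
    ∃ g : V → V, (∀ v, G.Adj v (g v)) ∧ (∀ v, g (g v) = v) ∧ ∀ u v, P.Adj u v → g u = v := by
  have h := Subgraph.isPerfectMatching_iff.1 hP
  choose g hg hu using h
  exact ⟨g, fun v => (hg v).adj_sub, fun v => (hu _ _ (hg v).symm).symm,
    fun u v huv => (hu u v huv).symm⟩

theorem IsExtendable.exists_involution (h : IsExtendable G 2) :
    ∃ g : V → V, (∀ v, G.Adj v (g v)) ∧ ∀ v, g (g v) = v := by
  obtain ⟨-, ⟨M, hM, hcard⟩, hext⟩ := h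
  obtain ⟨P, hP, -⟩ := hext M hM hcard
  obtain ⟨g, h1, h2, -⟩ := hP.exists_involution
  exact ⟨g, h1, h2⟩

theorem isMatching_sup_subgraphOfAdj {a b c d : V} (hab : G.Adj a b) (hcd : G.Adj c d)
    (hac : a ≠ c) (had : a ≠ d) (hbc : b ≠ c) (hbd : b ≠ d) :
    (G.subgraphOfAdj hab ⊔ G.subgraphOfAdj hcd).IsMatching ∧
      (G.subgraphOfAdj hab ⊔ G.subgraphOfAdj hcd).edgeSet.ncard = 2 := by
  constructor
  · refine (Subgraph.IsMatching.subgraphOfAdj hab).sup (Subgraph.IsMatching.subgraphOfAdj hcd) ?_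
    rw [support_subgraphOfAdj, support_subgraphOfAdj]
    simp [hac.symm, had.symm, hbc.symm, hbd.symm]
  · rw [Subgraph.edgeSet_sup, edgeSet_subgraphOfAdj, edgeSet_subgraphOfAdj]
    refine Set.ncard_pair ?_
    simp [hac, had]

theorem IsExtendable.exists_involution_of_two_edges (h : IsExtendable G 2) {a b c d : V}
    (hab : G.Adj a b) (hcd : G.Adj c d) (hac : a ≠ c) (had : a ≠ d) (hbc : b ≠ c) (hbd : b ≠ d) :
    ∃ g : V → V, (∀ v, G.Adj v (g v)) ∧ (∀ v, g (g v) = v) ∧ g a = b ∧ g c = d := by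
  obtain ⟨hM, hcard⟩ := isMatching_sup_subgraphOfAdj hab hcd hac had hbc hbd
  obtain ⟨P, hP, hle⟩ := h.2.2 _ hM hcard
  obtain ⟨g, h1, h2, h3⟩ := hP.exists_involution
  exact ⟨g, h1, h2, h3 _ _ (hle.2 (by simp)), h3 _ _ (hle.2 (by simp))⟩

variable [Fintype V]

theorem IsExtendable.exists_involution_of_edge (h : IsExtendable G 2) (hV : 5 < Fintype.card V)
    {a b : V} (hab : G.Adj a b) :
    ∃ g : V → V, (∀ v, G.Adj v (g v)) ∧ (∀ v, g (g v) = v) ∧ g a = b := by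
  classical
  obtain ⟨g, hg, hgg⟩ := h.exists_involution
  obtain ⟨c, hc⟩ : ∃ c, c ∉ ({a, b, g a, g b} : Finset V) := by
    by_contra! hc
    have := Finset.card_le_four (a := a) (b := b) (c := g a) (d := g b)
    rw [Finset.eq_univ_of_forall hc, Finset.card_univ] at this
    omega
  simp only [Finset.mem_insert, Finset.mem_singleton, not_or] at hc
  obtain ⟨h1, h2, h3, h4⟩ := hc
  obtain ⟨g', hg', hgg', ha, -⟩ := h.exists_involution_of_two_edges hab (hg c) (Ne.symm h1)
    (fun he => h3 (by rw [he, hgg])) (Ne.symm h2) (fun he => h4 (by rw [he, hgg]))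
  exact ⟨g', hg', hgg', ha⟩

end Extendable

section Sparse

variable {V : Type*} {G : SimpleGraph V}

theorem IsExtendable.exists_adj_notMem_pair [Fintype V] (h : IsExtendable G 2)
    (hV : 5 < Fintype.card V) {a b v : V} (hab : G.Adj a b) (ha : v ≠ a) (hb : v ≠ b) :
    ∃ w, G.Adj v w ∧ w ≠ a ∧ w ≠ b := by
  obtain ⟨g, hg, hgg, h1⟩ := h.exists_involution_of_edge hV hab
  refine ⟨g v, hg v, fun e => hb ?_, fun e => ha ?_⟩
  · rw [← hgg v, e, h1]
  · rw [← hgg v, e, ← h1, hgg]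

theorem IsExtendable.exists_adj_notMem_two_pairs (h : IsExtendable G 2) {a b c d v : V}
    (hab : G.Adj a b) (hcd : G.Adj c d) (hac : a ≠ c) (had : a ≠ d) (hbc : b ≠ c) (hbd : b ≠ d)
    (ha : v ≠ a) (hb : v ≠ b) (hc : v ≠ c) (hd : v ≠ d) :
    ∃ w, G.Adj v w ∧ w ≠ a ∧ w ≠ b ∧ w ≠ c ∧ w ≠ d := by
  obtain ⟨g, hg, hgg, h1, h2⟩ := h.exists_involution_of_two_edges hab hcd hac had hbc hbd
  refine ⟨g v, hg v, fun e => hb ?_, fun e => ha ?_, fun e => hd ?_, fun e => hc ?_⟩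
  · rw [← hgg v, e, h1]
  · rw [← hgg v, e, ← h1, hgg]
  · rw [← hgg v, e, h2]
  · rw [← hgg v, e, ← h2, hgg]

theorem SimpleGraph.Connected.exists_adj_notMem (h : G.Connected) {S : Set V} (hS : S.Nonempty)
    (hS' : S ≠ Set.univ) : ∃ a ∈ S, ∃ b ∉ S, G.Adj a b := by
  obtain ⟨x, hx⟩ := hS
  obtain ⟨y, hy⟩ := (Set.ne_univ_iff_exists_notMem S).1 hS'
  obtain ⟨p⟩ := h.preconnected x y
  obtain ⟨d, -, h1, h2⟩ := p.exists_boundary_dart S hx hy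
  exact ⟨_, h1, _, h2, d.adj⟩

theorem Finset.coe_ne_univ_of_card_lt [Fintype V] {s : Finset V} (h : s.card < Fintype.card V) :
    (s : Set V) ≠ Set.univ := by
  intro he
  rw [Finset.coe_eq_univ] at he
  rw [he, Finset.card_univ] at h
  exact lt_irrefl _ h

theorem SimpleGraph.Connected.exists_adj_notMem_four [Fintype V] (h : G.Connected)
    (hV : 5 < Fintype.card V) (a b c d : V) :
    ∃ x, (x = a ∨ x = b ∨ x = c ∨ x = d) ∧ ∃ y, (y ≠ a ∧ y ≠ b ∧ y ≠ c ∧ y ≠ d) ∧ G.Adj x y := by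
  classical
  have hcard : ({a, b, c, d} : Finset V).card < Fintype.card V :=
    Finset.card_le_four.trans_lt (by omega)
  obtain ⟨x, hx, y, hy, hxy⟩ := h.exists_adj_notMem (S := (({a, b, c, d} : Finset V) : Set V))
    ⟨a, by simp⟩ (Finset.coe_ne_univ_of_card_lt hcard)
  exact ⟨x, by simpa using hx, y, by simpa using hy, hxy⟩

variable [Fintype V]

theorem IsExtendable.exists_two_neighbors (h : IsExtendable G 2) (hV : 5 < Fintype.card V)
    (v : V) : ∃ a b, G.Adj v a ∧ G.Adj v b ∧ a ≠ b := by
  obtain ⟨g, hg, -⟩ := h.exists_involution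
  obtain ⟨x, hx, y, ⟨hyv, hya, -⟩, hxy⟩ := h.1.exists_adj_notMem_four hV v (g v) v v
  obtain rfl | rfl : x = v ∨ x = g v := by tauto
  · exact ⟨g x, y, hg x, hxy, hya.symm⟩
  · obtain ⟨w, hw, hwa, -⟩ := h.exists_adj_notMem_pair hV hxy (hg v).ne hyv.symm
    exact ⟨g v, w, hg v, hw, hwa.symm⟩

theorem IsExtendable.exists_third_neighbor (h : IsExtendable G 2) (hV : 5 < Fintype.card V)
    {v a b : V} (ha : G.Adj v a) (hb : G.Adj v b) (hab : a ≠ b) :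
    ∃ c, G.Adj v c ∧ c ≠ a ∧ c ≠ b := by
  by_contra! hN
  have hnab : ¬G.Adj a b := fun e => by
    obtain ⟨w, hw, h1, h2⟩ := h.exists_adj_notMem_pair hV e ha.ne hb.ne
    exact h2 (hN w hw h1)
  have only : ∀ {a b z : V}, G.Adj v a → G.Adj v b → a ≠ b →
      (∀ c, G.Adj v c → c ≠ a → c = b) → ¬G.Adj a b → G.Adj b z → z ≠ v → z ≠ a →
      ∀ x, G.Adj a x → x = v ∨ x = z := by
    intro a b z ha hb hab hN hnab hbz hzv hza x hx
    by_contra! hne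
    obtain ⟨w, hw, h1, -, h2, -⟩ := h.exists_adj_notMem_two_pairs hx hbz hab hza.symm
      (fun e => hnab (e ▸ hx)) hne.2 ha.ne hne.1.symm hb.ne hzv.symm
    exact h2 (hN w hw h1)
  have hN' : ∀ c, G.Adj v c → c ≠ b → c = a := fun c hc hcb => by
    by_contra hca
    exact hcb (hN c hc hca)
  obtain ⟨g, hg, hgg, h1⟩ := h.exists_involution_of_edge hV ha
  have hzv : g b ≠ v := fun e => hab (by rw [← h1, ← e, hgg])
  have hza : g b ≠ a := fun e => hb.ne (by rw [← hgg b, e, ← h1, hgg])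
  have hNa := only ha hb hab hN hnab (hg b) hzv hza
  obtain ⟨g', hg', hgg', h1'⟩ := h.exists_involution_of_edge hV hb
  have haz : G.Adj a (g b) := by
    rcases hNa _ (hg' a) with e | e
    · exact absurd (by rw [← h1', ← e, hgg']) hab
    · exact e ▸ hg' a
  have hNb := only hb ha hab.symm hN' (fun e => hnab e.symm) haz hzv (hg b).ne'
  obtain ⟨x, hx, y, ⟨hyv, hya, hyb, hyz⟩, hxy⟩ := h.1.exists_adj_notMem_four hV v a b (g b)
  rcases hx with rfl | rfl | rfl | rfl
  · exact hyb (hN y hxy hya)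
  · exact (hNa y hxy).elim hyv hyz
  · exact (hNb y hxy).elim hyv hyz
  · obtain ⟨f, hf, hff, hfz⟩ := h.exists_involution_of_edge hV hxy
    have key : ∀ {c d : V}, f v = c → d ≠ c → y ≠ d → (∀ x, G.Adj d x → x = v ∨ x = g b) →
        False := by
      intro c d hc hdc hyd hd
      rcases hd _ (hf d) with e | e
      · exact hdc (by rw [← hc, ← e, hff])
      · exact hyd (by rw [← hfz, ← e, hff])
    by_cases hva : f v = a
    · exact key hva hab.symm hyb hNb
    · exact key (hN _ (hf v) hva) hab hya hNa

theorem IsExtendable.three_le_ncard_neighborSet (h : IsExtendable G 2)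
    (hV : 5 < Fintype.card V) (v : V) : 3 ≤ (G.neighborSet v).ncard := by
  obtain ⟨a, b, ha, hb, hab⟩ := h.exists_two_neighbors hV v
  obtain ⟨c, hc, hca, hcb⟩ := h.exists_third_neighbor hV ha hb hab
  rw [← Set.ncard_eq_three.2 ⟨a, b, c, hab, hca.symm, hcb.symm, rfl⟩]
  refine Set.ncard_le_ncard ?_ (Set.toFinite _)
  rintro x (rfl | rfl | rfl)
  exacts [ha, hb, hc]

theorem IsExtendable.four_le_ncard_of_triangle (h : IsExtendable G 2)
    (hV : 5 < Fintype.card V) {v a b : V} (ha : G.Adj v a) (hb : G.Adj v b) (hab : G.Adj a b) :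
    4 ≤ (G.neighborSet v).ncard := by
  have h3 := h.three_le_ncard_neighborSet hV
  by_contra hlt
  have hv : (G.neighborSet v).ncard = 3 := by have := h3 v; omega
  obtain ⟨c, hc⟩ : ∃ c, G.neighborSet v \ {a, b} = {c} := by
    rw [← Set.ncard_eq_one, Set.ncard_sdiff (by rintro x (rfl | rfl) <;> assumption)
      (Set.toFinite _), hv, Set.ncard_pair hab.ne]
  have hc' : G.Adj v c ∧ c ≠ a ∧ c ≠ b := by
    have : c ∈ G.neighborSet v \ {a, b} := hc ▸ rfl
    simpa using this
  have hN : ∀ x, G.Adj v x → x = a ∨ x = b ∨ x = c := fun x hx => by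
    by_contra! hne
    have : x ∈ G.neighborSet v \ {a, b} := by simp [hx, hne.1, hne.2.1]
    rw [hc] at this
    exact hne.2.2 this
  have closed : ∀ {a b c : V}, G.Adj v a → G.Adj v b → G.Adj v c → G.Adj a b → c ≠ a → c ≠ b →
      (∀ x, G.Adj v x → x = a ∨ x = b ∨ x = c) → ∀ x, G.Adj c x → x = v ∨ x = a ∨ x = b := by
    intro a b c ha hb hc hab hca hcb hN x hx
    by_contra! hne
    obtain ⟨w, hw, h1, h2, h4, -⟩ := h.exists_adj_notMem_two_pairs hab hx hca.symm
      hne.2.1.symm hcb.symm hne.2.2.symm ha.ne hb.ne hc.ne hne.1.symm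
    rcases hN w hw with e | e | e <;> contradiction
  obtain ⟨hvc, hca, hcb⟩ := hc'
  have hNc := closed ha hb hvc hab hca hcb hN
  have hadj : ∀ y z : V, (∀ x, G.Adj c x → x = v ∨ x = y ∨ x = z) → G.Adj c y := by
    intro y z hyz
    by_contra hy
    have := (Set.ncard_le_ncard (s := G.neighborSet c) (t := {v, z})
      (fun x hx => by
        rcases hyz x hx with e | e | e
        · exact Or.inl e
        · exact absurd (e ▸ hx) hy
        · exact Or.inr e) (Set.toFinite _)).trans (Set.ncard_insert_le _ _)
    rw [Set.ncard_singleton] at this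
    have := h3 c
    omega
  have hac := (hadj a b hNc).symm
  have hbc := (hadj b a fun x hx => by have := hNc x hx; tauto).symm
  have hNb := closed ha hvc hb hac hab.ne' hcb.symm fun x hx => by have := hN x hx; tauto
  have hNa := closed hb hvc ha hbc hab.ne hca.symm fun x hx => by have := hN x hx; tauto
  obtain ⟨x, hx, y, hy, hxy⟩ := h.1.exists_adj_notMem_four hV v a b c
  rcases hx with rfl | rfl | rfl | rfl
  · have := hN y hxy; tauto
  · have := hNa y hxy; tauto
  · have := hNb y hxy; tauto
  · have := hNc y hxy; tauto

theorem IsExtendable.isSparse (h : IsExtendable G 2) (hV : Fintype.card V = 12)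
    (hE : G.edgeSet.ncard ≤ 19) : IsSparse G := by
  classical
  have hV5 : 5 < Fintype.card V := by omega
  have h3 := h.three_le_ncard_neighborSet hV5
  have hexcess : ∑ v, ((G.neighborSet v).ncard - 3) ≤ 2 := by
    have hsum : ∑ v, (G.neighborSet v).ncard = 2 * G.edgeSet.ncard := by
      rw [← coe_edgeFinset, Set.ncard_coe_finset, ← sum_degrees_eq_twice_card_edges]
      exact Finset.sum_congr rfl fun v _ => Set.ncard_eq_toFinset_card' _
    have hsplit : ∑ v, (G.neighborSet v).ncard = ∑ v, ((G.neighborSet v).ncard - 3) + 36 := by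
      rw [show 36 = ∑ _v : V, 3 by simp [hV], ← Finset.sum_add_distrib]
      exact Finset.sum_congr rfl fun v _ => (Nat.sub_add_cancel (h3 v)).symm
    omega
  refine ⟨hV, h3, hexcess, fun a b c hab hbc hac => ?_, fun S => h.1.exists_adj_notMem,
    fun a b c d => h.exists_involution_of_two_edges⟩
  have hsub := Finset.sum_le_univ_sum_of_nonneg (s := {a, b, c})
    (f := fun v => (G.neighborSet v).ncard - 3) fun _ => Nat.zero_le _
  rw [Finset.sum_insert (by simp [hab.ne, hac.ne]), Finset.sum_pair hbc.ne] at hsub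
  have h1 := h.four_le_ncard_of_triangle hV5 hab hac hbc
  have h2 := h.four_le_ncard_of_triangle hV5 hab.symm hbc hac
  have h4 := h.four_le_ncard_of_triangle hV5 hac.symm hbc.symm hab
  omega

end Sparse

section Example

theorem isExtendable_two_of_involutions {V : Type*} {G : SimpleGraph V} (hconn : G.Connected)
    (hedges : ∃ a b c d, G.Adj a b ∧ G.Adj c d ∧ a ≠ c ∧ a ≠ d ∧ b ≠ c ∧ b ≠ d)
    (hext : ∀ a b, G.Adj a b → ∀ c d, G.Adj c d → a ≠ c → a ≠ d → b ≠ c → b ≠ d →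
      ∃ g : V → V, (∀ v, G.Adj v (g v)) ∧ (∀ v, g (g v) = v) ∧ g a = b ∧ g c = d) :
    IsExtendable G 2 := by
  refine ⟨hconn, ?_, fun M hM hcard => ?_⟩
  · obtain ⟨a, b, c, d, hab, hcd, hac, had, hbc, hbd⟩ := hedges
    exact ⟨_, isMatching_sup_subgraphOfAdj hab hcd hac had hbc hbd⟩
  obtain ⟨e₁, e₂, hne, he⟩ := Set.ncard_eq_two.1 hcard
  induction e₁ with | _ a b
  induction e₂ with | _ c d
  have hab : M.Adj a b := by rw [← Subgraph.mem_edgeSet, he]; simp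
  have hcd : M.Adj c d := by rw [← Subgraph.mem_edgeSet, he]; simp
  have uniq : ∀ {x y z}, M.Adj x y → M.Adj x z → y = z := fun hy hz =>
    (hM (M.edge_vert hy)).unique hy hz
  obtain ⟨g, hg, hgg, h1, h2⟩ := hext a b hab.adj_sub c d hcd.adj_sub
    (fun h => hne (by subst h; rw [uniq hab hcd]))
    (fun h => hne (by subst h; rw [uniq hab hcd.symm, Sym2.eq_swap]))
    (fun h => hne (by subst h; rw [uniq hab.symm hcd, Sym2.eq_swap]))
    (fun h => hne (by subst h; rw [uniq hab.symm hcd.symm]))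
  let P : G.Subgraph :=
    { verts := Set.univ
      Adj := fun u v => g u = v
      adj_sub := fun h => h ▸ hg _
      edge_vert := fun _ => Set.mem_univ _
      symm := ⟨fun u v h => by rw [← h, hgg]⟩ }
  refine ⟨P, Subgraph.isPerfectMatching_iff.2 fun v => ⟨g v, rfl, fun w hw => Eq.symm hw⟩,
    Set.subset_univ _, fun u v huv => ?_⟩
  rw [← Subgraph.mem_edgeSet, he] at huv
  change g u = v
  rcases huv with h | h <;> rcases Sym2.eq_iff.1 h with ⟨rfl, rfl⟩ | ⟨rfl, rfl⟩
  · exact h1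
  · rw [← h1, hgg]
  · exact h2
  · rw [← h2, hgg]

/-- The edges of a 2-extendable non-bipartite graph of order 12 and size 20. -/
def exampleEdges : List (ℕ × ℕ) :=
  [(0, 3), (0, 9), (0, 11), (1, 2), (1, 7), (1, 8), (1, 11), (2, 3), (2, 5), (2, 10), (3, 4),
    (4, 7), (4, 10), (5, 6), (5, 7), (6, 8), (6, 11), (8, 9), (9, 10), (10, 11)]

def exampleGraph : SimpleGraph (Fin 12) where
  Adj a b := (a.val, b.val) ∈ exampleEdges ∨ (b.val, a.val) ∈ exampleEdges
  symm := ⟨fun _ _ h => h.symm⟩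
  loopless := ⟨by decide⟩

instance : DecidableRel exampleGraph.Adj := fun a b =>
  inferInstanceAs (Decidable ((a.val, b.val) ∈ exampleEdges ∨ (b.val, a.val) ∈ exampleEdges))

theorem ncard_exampleGraph_edgeSet : exampleGraph.edgeSet.ncard = 20 := by
  rw [← coe_edgeFinset, Set.ncard_coe_finset]
  decide +kernel

/-- The perfect matchings of `exampleGraph`, each vertex being replaced by its partner. -/
def exampleMatchings : List (List (Fin 12)) :=
  [[3, 2, 1, 0, 7, 6, 5, 4, 9, 8, 11, 10],
    [9, 7, 5, 4, 3, 2, 8, 1, 6, 0, 11, 10],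
    [9, 8, 3, 2, 10, 7, 11, 5, 1, 0, 4, 6],
    [11, 2, 1, 4, 3, 7, 8, 5, 6, 10, 9, 0],
    [3, 8, 5, 0, 7, 2, 11, 4, 1, 10, 9, 6],
    [11, 7, 3, 2, 10, 6, 5, 1, 9, 8, 4, 0],
    [3, 11, 10, 0, 7, 6, 5, 4, 9, 8, 2, 1],
    [9, 11, 10, 4, 3, 7, 8, 5, 6, 0, 2, 1],
    [3, 2, 1, 0, 10, 7, 11, 5, 9, 8, 4, 6],
    [9, 8, 3, 2, 7, 6, 5, 4, 1, 0, 11, 10],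
    [3, 7, 5, 0, 10, 2, 11, 1, 9, 8, 4, 6],
    [3, 11, 5, 0, 7, 2, 8, 4, 6, 10, 9, 1],
    [9, 8, 10, 4, 3, 7, 11, 5, 1, 0, 2, 6],
    [9, 11, 3, 2, 10, 7, 8, 5, 6, 0, 4, 1],
    [11, 7, 10, 4, 3, 6, 5, 1, 9, 8, 2, 0],
    [11, 8, 3, 2, 7, 6, 5, 4, 1, 10, 9, 0],
    [9, 2, 1, 4, 3, 7, 8, 5, 6, 0, 11, 10],
    [11, 7, 5, 4, 3, 2, 8, 1, 6, 10, 9, 0]]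

theorem exampleMatchings_involutive : ∀ l ∈ exampleMatchings, ∀ v : Fin 12,
    exampleGraph.Adj v (l.getD v 0) ∧ l.getD (l.getD v 0) 0 = v := by
  decide +kernel

theorem exists_mem_exampleMatchings : ∀ a b, exampleGraph.Adj a b →
    ∀ c d, exampleGraph.Adj c d → (a = c ∨ a = d ∨ b = c ∨ b = d) ∨
      ∃ l ∈ exampleMatchings, l.getD a 0 = b ∧ l.getD c 0 = d := by
  decide +kernel

theorem exampleGraph_connected : exampleGraph.Connected := by
  have h : ∀ v, exampleGraph.Adj 0 v ∨ ∃ a, exampleGraph.Adj 0 a ∧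
      (exampleGraph.Adj a v ∨ ∃ b, exampleGraph.Adj a b ∧ exampleGraph.Adj b v) := by
    decide +kernel
  have hr : ∀ v, exampleGraph.Reachable 0 v := fun v => by
    rcases h v with h | ⟨a, ha, h | ⟨b, hb, h⟩⟩
    · exact h.reachable
    · exact ha.reachable.trans h.reachable
    · exact ha.reachable.trans (hb.reachable.trans h.reachable)
  exact ⟨fun u v => (hr u).symm.trans (hr v)⟩

theorem exampleGraph_isExtendable : IsExtendable exampleGraph 2 := by
  refine isExtendable_two_of_involutions exampleGraph_connected
    ⟨0, 3, 1, 2, by decide, by decide, by decide, by decide, by decide, by decide⟩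
    fun a b hab c d hcd hac had hbc hbd => ?_
  obtain ⟨l, hl, h1, h2⟩ :=
    (exists_mem_exampleMatchings a b hab c d hcd).resolve_left (by tauto)
  have := exampleMatchings_involutive l hl
  exact ⟨fun v => l.getD v 0, fun v => (this v).1, fun v => (this v).2, h1, h2⟩

theorem exampleGraph_not_colorable : ¬exampleGraph.Colorable 2 := by
  rintro ⟨C⟩
  have h1 := C.valid (show exampleGraph.Adj 0 3 by decide)
  have h2 := C.valid (show exampleGraph.Adj 3 4 by decide)
  have h3 := C.valid (show exampleGraph.Adj 4 10 by decide)
  have h4 := C.valid (show exampleGraph.Adj 10 9 by decide)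
  have h5 := C.valid (show exampleGraph.Adj 9 0 by decide)
  omega

end Example

theorem eps_twelve_two :
    (∀ (V : Type) [Fintype V] (G : SimpleGraph V), Fintype.card V = 12 →
      IsExtendable G 2 → ¬ G.Colorable 2 → 20 ≤ G.edgeSet.ncard) ∧
    (∃ G : SimpleGraph (Fin 12), IsExtendable G 2 ∧ ¬ G.Colorable 2 ∧
      G.edgeSet.ncard = 20) := by
  refine ⟨fun V _ G hV hG hc => ?_, exampleGraph, exampleGraph_isExtendable,
    exampleGraph_not_colorable, ncard_exampleGraph_edgeSet⟩
  by_contra hlt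
  exact hc ((hG.isSparse hV (by omega)).colorable_two hG.1)
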